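/- (Quantitative non-divergence, specialized) Let n ≥ 2 be an integer, p a prime, and set α := 1/⌊((n+1)/2)²⌋. Then there exists K > 0 depending only on n and p with the following property. For any 0 < v ≤ 1 and any nonempty ball B ⊆ ℤ_p there exists Q₀ = Q₀(B, n, p, v) such that: for every Q ≥ Q₀ which is an integer power of p, every δ ∈ (0,1) that is an integer power of p, all ξ₀, …, ξ_n which are integer powers of p with 0 < ξ₀ ≤ ξ₁ ≤ ⋯ ≤ ξ_n = 1, ∏_{i=0}^{n} ξ_i = Q^{−(n+1)} and ξ₀ ≤ Q^{−1−v}, and every 0 < ε ≤ 1, one has μ( { x ∈ B : ∃ (a₀, …, a_n) ∈ ℤ[1/p]^{n+1} \ {0} with ( max_{0≤i≤n} (δ/ξ_i) · | Σ_{j=i}^{n} C(j,i) a_j x^{j−i} |_p ) · ( max_{0≤j≤n} |a_j| / (δ Q) ) < ε } ) ≤ K ε^{α} μ(B). Here each a_j ∈ ℤ[1/p] is viewed both as an element of ℚ_p (for |·|_p) and of ℝ (for the ordinary absolute value |·|). -/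

import Mathlib

open Polynomial MeasureTheory

noncomputable instance (p : ℕ) [Fact p.Prime] : MeasurableSpace ℚ_[p] := borel _
instance (p : ℕ) [Fact p.Prime] : BorelSpace ℚ_[p] := ⟨rfl⟩

namespace QuantNondiv

section Balls

variable {p : ℕ} [hp : Fact p.Prime]

lemma zpow_le_zpow_iff_prime {a b : ℤ} : (p : ℝ) ^ a ≤ (p : ℝ) ^ b ↔ a ≤ b :=
  zpow_le_zpow_iff_right₀ (by exact_mod_cast hp.out.one_lt)

lemma prime_zpow_pos (k : ℤ) : (0 : ℝ) < (p : ℝ) ^ k :=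
  zpow_pos (by exact_mod_cast hp.out.pos) k

lemma closedBall_eq_iUnion (c : ℚ_[p]) (k : ℤ) :
    Metric.closedBall c ((p : ℝ) ^ (-k)) =
      ⋃ i ∈ Finset.range p, Metric.closedBall (c + i * (p : ℚ_[p]) ^ k) ((p : ℝ) ^ (-(k + 1))) := by
  have hp0 : (p : ℚ_[p]) ≠ 0 := by exact_mod_cast hp.out.ne_zero
  ext x
  simp only [Metric.mem_closedBall, Set.mem_iUnion, dist_eq_norm, exists_prop, Finset.mem_range]
  constructor
  · intro hx
    have hz : ‖(x - c) / (p : ℚ_[p]) ^ k‖ ≤ 1 := by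
      rw [norm_div, Padic.norm_p_zpow, div_le_one (prime_zpow_pos _)]
      exact hx
    obtain ⟨z, hz⟩ : ∃ z : ℤ_[p], (z : ℚ_[p]) = (x - c) / (p : ℚ_[p]) ^ k := ⟨⟨_, hz⟩, rfl⟩
    obtain ⟨i, hi, hmem⟩ := PadicInt.exists_mem_range z
    refine ⟨i, hi, ?_⟩
    have h1 : ‖(x - c) / (p : ℚ_[p]) ^ k - i‖ < (p : ℝ) ^ (0 : ℤ) := by
      have := PadicInt.mem_nonunits.1 ((IsLocalRing.mem_maximalIdeal _).1 hmem)
      rw [PadicInt.norm_def, PadicInt.coe_sub, PadicInt.coe_natCast, hz] at this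
      simpa using this
    have h2 : ‖(x - c) / (p : ℚ_[p]) ^ k - i‖ ≤ (p : ℝ) ^ (-1 : ℤ) := by
      rw [Padic.norm_le_pow_iff_norm_lt_pow_add_one]; simpa using h1
    have h3 : x - (c + i * (p : ℚ_[p]) ^ k) = ((x - c) / (p : ℚ_[p]) ^ k - i) * (p : ℚ_[p]) ^ k := by
      have := zpow_ne_zero k hp0
      field_simp
      ring
    rw [h3, norm_mul, Padic.norm_p_zpow]
    calc _ ≤ (p : ℝ) ^ (-1 : ℤ) * (p : ℝ) ^ (-k) := by gcongr
      _ = (p : ℝ) ^ (-(k + 1)) := by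
        rw [← zpow_add₀ (by exact_mod_cast hp.out.ne_zero)]; congr 1; ring
  · rintro ⟨i, -, hx⟩
    have h3 : x - c = (x - (c + i * (p : ℚ_[p]) ^ k)) + i * (p : ℚ_[p]) ^ k := by ring
    rw [h3]
    refine (IsUltrametricDist.norm_add_le_max _ _).trans (max_le (hx.trans ?_) ?_)
    · rw [zpow_le_zpow_iff_prime]; omega
    · rw [norm_mul, Padic.norm_p_zpow]
      exact mul_le_of_le_one_left (prime_zpow_pos _).le
        (by simpa using IsUltrametricDist.norm_natCast_le_one ℚ_[p] i)

lemma disjoint_closedBall_translates (c : ℚ_[p]) (k : ℤ) :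
    (↑(Finset.range p) : Set ℕ).PairwiseDisjoint
      fun i : ℕ => Metric.closedBall (c + i * (p : ℚ_[p]) ^ k) ((p : ℝ) ^ (-(k + 1))) := by
  intro i hi j hj hij
  rw [Function.onFun, Set.disjoint_left]
  intro x hx hx'
  rw [Metric.mem_closedBall, dist_eq_norm] at hx hx'
  simp only [Finset.coe_range, Set.mem_Iio] at hi hj
  have h1 : ‖(((i : ℤ) - (j : ℤ) : ℤ) : ℚ_[p])‖ = 1 := by
    by_contra h
    have := lt_of_le_of_ne (Padic.norm_int_le_one ((i : ℤ) - j)) h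
    rw [Padic.norm_intCast_lt_one_iff] at this
    have h0 := Int.eq_zero_of_abs_lt_dvd this (by rw [abs_lt]; constructor <;> omega)
    omega
  have h2 : (((i : ℤ) - (j : ℤ) : ℤ) : ℚ_[p]) * (p : ℚ_[p]) ^ k =
      (x - (c + j * (p : ℚ_[p]) ^ k)) - (x - (c + i * (p : ℚ_[p]) ^ k)) := by
    push_cast; ring
  have h3 : ‖(((i : ℤ) - (j : ℤ) : ℤ) : ℚ_[p]) * (p : ℚ_[p]) ^ k‖ ≤ (p : ℝ) ^ (-(k + 1)) := by
    rw [h2, sub_eq_add_neg]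
    refine (IsUltrametricDist.norm_add_le_max _ _).trans (max_le hx' ?_)
    rwa [norm_neg]
  rw [norm_mul, h1, one_mul, Padic.norm_p_zpow, zpow_le_zpow_iff_prime] at h3
  omega

lemma measurableSet_closedBall' (c : ℚ_[p]) (r : ℝ) : MeasurableSet (Metric.closedBall c r) :=
  Metric.isClosed_closedBall.measurableSet

lemma measure_closedBall_translate (μ : Measure ℚ_[p]) [μ.IsAddHaarMeasure] (c d : ℚ_[p]) (r : ℝ) :
    μ (Metric.closedBall c r) = μ (Metric.closedBall d r) := by
  rw [← measure_preimage_add μ (c - d)]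
  congr 1
  ext x
  simp only [Set.mem_preimage, Metric.mem_closedBall, dist_eq_norm]
  rw [show c - d + x - c = x - d by ring]

lemma measure_closedBall_eq_mul (μ : Measure ℚ_[p]) [μ.IsAddHaarMeasure] (c : ℚ_[p]) (k : ℤ) :
    μ (Metric.closedBall c ((p : ℝ) ^ (-k))) =
      p * μ (Metric.closedBall c ((p : ℝ) ^ (-(k + 1)))) := by
  rw [closedBall_eq_iUnion, measure_biUnion_finset (disjoint_closedBall_translates c k)
    fun i _ => measurableSet_closedBall' _ _]
  rw [Finset.sum_congr rfl fun (i : ℕ) _ => measure_closedBall_translate μ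
    (c + i * (p : ℚ_[p]) ^ k) c ((p : ℝ) ^ (-(k + 1)))]
  rw [Finset.sum_const, Finset.card_range, nsmul_eq_mul]

lemma measure_closedBall_mul_pow (μ : Measure ℚ_[p]) [μ.IsAddHaarMeasure] (c : ℚ_[p]) (k : ℤ)
    (j : ℕ) :
    μ (Metric.closedBall c ((p : ℝ) ^ (-k))) =
      (p : ENNReal) ^ j * μ (Metric.closedBall c ((p : ℝ) ^ (-(k + j)))) := by
  induction j with
  | zero => simp
  | succ j ih =>
    rw [ih, measure_closedBall_eq_mul, ← mul_assoc, ← pow_succ]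
    push_cast
    rw [add_assoc]

end Balls

end QuantNondiv
namespace QuantNondiv

section Marking

variable {p : ℕ} [hp : Fact p.Prime]

lemma closedBall_level_anti (c : ℚ_[p]) {i j : ℤ} (h : i ≤ j) :
    Metric.closedBall c ((p : ℝ) ^ (-j)) ⊆ Metric.closedBall c ((p : ℝ) ^ (-i)) :=
  Metric.closedBall_subset_closedBall (zpow_le_zpow_iff_prime.2 (by omega))

lemma measure_le_of_locally_le (μ : Measure ℚ_[p]) [μ.IsAddHaarMeasure] {E : Set ℚ_[p]}
    {c : ℚ_[p]} {k : ℤ} (hE : E ⊆ Metric.closedBall c ((p : ℝ) ^ (-k))) {C : ENNReal}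
    (h : ∀ x ∈ E, ∃ i : ℕ, μ (E ∩ Metric.closedBall x ((p : ℝ) ^ (-(k + i)))) ≤
      C * μ (Metric.closedBall x ((p : ℝ) ^ (-(k + i))))) :
    μ E ≤ C * μ (Metric.closedBall c ((p : ℝ) ^ (-k))) := by
  classical
  have hex : ∀ x : E, ∃ i : ℕ, μ (E ∩ Metric.closedBall (x : ℚ_[p]) ((p : ℝ) ^ (-(k + i)))) ≤
      C * μ (Metric.closedBall (x : ℚ_[p]) ((p : ℝ) ^ (-(k + i)))) := fun x => h x x.2
  set B : E → Set ℚ_[p] :=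
    fun x => Metric.closedBall (x : ℚ_[p]) ((p : ℝ) ^ (-(k + (Nat.find (hex x) : ℕ)))) with hB
  have key : ∀ x y : E, Nat.find (hex x) ≤ Nat.find (hex y) → ¬ Disjoint (B x) (B y) →
      B x = B y := by
    intro x y hxy hd
    obtain ⟨z, hzx, hzy⟩ := Set.not_disjoint_iff.1 hd
    have e1 := IsUltrametricDist.closedBall_eq_of_mem hzx
    have e2 := IsUltrametricDist.closedBall_eq_of_mem hzy
    have hyx : (y : ℚ_[p]) ∈ B x := by
      rw [hB]
      simp only
      rw [e1]
      refine closedBall_level_anti z (by omega) (e2 ▸ Metric.mem_closedBall_self ?_)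
      exact (prime_zpow_pos _).le
    have e3 := IsUltrametricDist.closedBall_eq_of_mem hyx
    have hle : Nat.find (hex y) ≤ Nat.find (hex x) := by
      refine Nat.find_min' _ ?_
      rw [← e3]
      exact Nat.find_spec (hex x)
    have heq := le_antisymm hxy hle
    simp only [hB, e3, heq]
  set F : Set (Set ℚ_[p]) := Set.range B
  have hdisj : F.PairwiseDisjoint id := by
    rintro _ ⟨x, rfl⟩ _ ⟨y, rfl⟩ hne
    by_contra hd
    rcases le_total (Nat.find (hex x)) (Nat.find (hex y)) with hxy | hxy
    · exact hne (key x y hxy hd)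
    · exact hne (key y x hxy fun h' => hd h'.symm).symm
  have hcount : F.Countable := hdisj.countable_of_isOpen
    (by rintro _ ⟨x, rfl⟩; exact IsUltrametricDist.isOpen_closedBall _ (prime_zpow_pos _).ne')
    (by rintro _ ⟨x, rfl⟩; exact ⟨x, Metric.mem_closedBall_self (prime_zpow_pos _).le⟩)
  have hcover : E ⊆ ⋃ b ∈ F, E ∩ b := fun x hx => Set.mem_biUnion (Set.mem_range_self ⟨x, hx⟩)
    ⟨hx, Metric.mem_closedBall_self (prime_zpow_pos _).le⟩
  calc μ E ≤ μ (⋃ b ∈ F, E ∩ b) := measure_mono hcover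
    _ ≤ ∑' b : F, μ (E ∩ (b : Set ℚ_[p])) := measure_biUnion_le μ hcount _
    _ ≤ ∑' b : F, C * μ (b : Set ℚ_[p]) := by
        refine ENNReal.tsum_le_tsum ?_
        rintro ⟨_, ⟨x, rfl⟩⟩
        exact Nat.find_spec (hex x)
    _ = C * μ (⋃ b ∈ F, b) := by
        rw [ENNReal.tsum_mul_left]
        congr 1
        refine (measure_biUnion hcount hdisj ?_).symm
        rintro _ ⟨x, rfl⟩
        exact measurableSet_closedBall' _ _
    _ ≤ C * μ (Metric.closedBall c ((p : ℝ) ^ (-k))) := by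
        gcongr
        refine Set.iUnion₂_subset ?_
        rintro _ ⟨x, rfl⟩
        rw [IsUltrametricDist.closedBall_eq_of_mem (hE x.2)]
        exact closedBall_level_anti _ (by omega)

/-- `x` is marked relative to the flag `F`: some flag extending `F` has all its new members of
size in `[ε, 1]` at `x`, and everything compatible with it has size at least `1` at `x`. -/
def Marked {S : Type*} (comp : S → S → Prop) (ψ : S → ℚ_[p] → ℝ) (ε : ℝ) (F : Finset S)
    (x : ℚ_[p]) : Prop :=
  ∃ F' : Finset S, F ⊆ F' ∧ (F' : Set S).Pairwise comp ∧
    (∀ s ∈ F', s ∉ F → ε ≤ ψ s x ∧ ψ s x ≤ 1) ∧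
    ∀ s, (∀ t ∈ F', comp s t) → 1 ≤ ψ s x

theorem measure_not_marked_le (μ : Measure ℚ_[p]) [μ.IsAddHaarMeasure] {S : Type*}
    (comp : S → S → Prop) (hsymm : ∀ s t, comp s t → comp t s) (hirr : ∀ s, ¬ comp s s) (N : ℕ)
    (hN : ∀ F : Finset S, (F : Set S).Pairwise comp → F.card ≤ N)
    (ψ : S → ℚ_[p] → ℝ) (hψ : ∀ s, Continuous (ψ s)) (ε : ℝ) (C : ENNReal)
    (hgood : ∀ s c (k : ℤ), (∃ y ∈ Metric.closedBall c ((p : ℝ) ^ (-k)), 1 ≤ ψ s y) →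
      μ {x ∈ Metric.closedBall c ((p : ℝ) ^ (-k)) | ψ s x < ε} ≤
        C * μ (Metric.closedBall c ((p : ℝ) ^ (-k))))
    (m : ℕ) (F : Finset S) (hF : (F : Set S).Pairwise comp) (hm : N ≤ F.card + m)
    (c : ℚ_[p]) (k : ℤ)
    (hbig : ∀ s, (∀ t ∈ F, comp s t) → ∃ y ∈ Metric.closedBall c ((p : ℝ) ^ (-k)), 1 ≤ ψ s y) :
    μ {x ∈ Metric.closedBall c ((p : ℝ) ^ (-k)) | ¬ Marked comp ψ ε F x} ≤
      ((2 * p : ℕ) : ENNReal) ^ m * C * μ (Metric.closedBall c ((p : ℝ) ^ (-k))) := by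
  classical
  induction m generalizing F c k with
  | zero =>
    have : {x ∈ Metric.closedBall c ((p : ℝ) ^ (-k)) | ¬ Marked comp ψ ε F x} = ∅ := by
      refine Set.eq_empty_iff_forall_notMem.2 fun x hx => hx.2 ?_
      refine ⟨F, subset_rfl, hF, fun s hs hs' => absurd hs hs', fun s hs => ?_⟩
      have hsF : s ∉ F := fun h => hirr s (hs s h)
      have := hN (insert s F) (by
        rw [Finset.coe_insert]
        exact hF.insert fun t ht _ => ⟨hs t ht, hsymm _ _ (hs t ht)⟩)
      rw [Finset.card_insert_of_notMem hsF] at this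
      omega
    rw [this]
    simp
  | succ m ih =>
    refine measure_le_of_locally_le μ (fun x hx => hx.1) ?_
    rintro x ⟨hxB, hx⟩
    have hs : ∃ s, (∀ t ∈ F, comp s t) ∧ ψ s x < 1 := by
      by_contra! hcon
      exact hx ⟨F, subset_rfl, hF, fun s hs hs' => absurd hs hs', hcon⟩
    have hlev : ∃ i : ℕ, ∃ s, (∀ t ∈ F, comp s t) ∧
        ∀ y ∈ Metric.closedBall x ((p : ℝ) ^ (-(k + i))), ψ s y < 1 := by
      obtain ⟨s, hsF, hsx⟩ := hs
      have hopen : {y | ψ s y < 1} ∈ nhds x :=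
        (isOpen_lt (hψ s) continuous_const).mem_nhds hsx
      obtain ⟨r, hr, hrs⟩ := Metric.nhds_basis_closedBall.mem_iff.1 hopen
      have hp1 : (1 : ℝ) < p := by exact_mod_cast hp.out.one_lt
      obtain ⟨i, hi⟩ := exists_pow_lt_of_lt_one
        (mul_pos hr (prime_zpow_pos (p := p) k)) (inv_lt_one_of_one_lt₀ hp1)
      refine ⟨i, s, hsF, fun y hy => hrs (Metric.closedBall_subset_closedBall ?_ hy)⟩
      rw [neg_add, zpow_add₀ (by positivity), zpow_neg, zpow_neg, zpow_natCast]
      rw [inv_mul_le_iff₀ (prime_zpow_pos k), ← inv_pow, mul_comm]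
      exact hi.le
    obtain ⟨s, hsF, hsB⟩ := Nat.find_spec hlev
    set i := Nat.find hlev with hi
    have hipos : i ≠ 0 := by
      intro h0
      obtain ⟨y, hy, hy1⟩ := hbig s hsF
      rw [IsUltrametricDist.closedBall_eq_of_mem hxB] at hy
      have := hsB y (by rw [h0]; simpa using hy)
      linarith
    obtain ⟨j, hj⟩ := Nat.exists_eq_succ_of_ne_zero hipos
    have hparent : ∀ t, (∀ u ∈ F, comp t u) →
        ∃ y ∈ Metric.closedBall x ((p : ℝ) ^ (-(k + j))), 1 ≤ ψ t y := by
      intro t ht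
      by_contra! hcon
      have := Nat.find_min hlev (m := j) (by omega)
      exact this ⟨t, ht, hcon⟩
    have hsnot : s ∉ F := fun h => hirr s (hsF s h)
    have hF' : ((insert s F : Finset S) : Set S).Pairwise comp := by
      rw [Finset.coe_insert]
      exact hF.insert fun t ht _ => ⟨hsF t ht, hsymm _ _ (hsF t ht)⟩
    have h1 := ih (insert s F) hF' (by rw [Finset.card_insert_of_notMem hsnot]; omega) x (k + j)
      (fun t ht => hparent t fun u hu => ht u (Finset.mem_insert_of_mem hu))
    have h2 := hgood s x (k + j) (hparent s hsF)
    refine ⟨i, ?_⟩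
    have hsub : {x ∈ Metric.closedBall c ((p : ℝ) ^ (-k)) | ¬ Marked comp ψ ε F x} ∩
        Metric.closedBall x ((p : ℝ) ^ (-(k + i))) ⊆
        {y ∈ Metric.closedBall x ((p : ℝ) ^ (-(k + j))) | ψ s y < ε} ∪
        {y ∈ Metric.closedBall x ((p : ℝ) ^ (-(k + j))) |
          ¬ Marked comp ψ ε (insert s F) y} := by
      rintro y ⟨⟨-, hy⟩, hyi⟩
      have hyj := closedBall_level_anti x (show k + j ≤ k + (i : ℤ) by omega) hyi
      by_cases hε : ψ s y < ε
      · exact Or.inl ⟨hyj, hε⟩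
      · refine Or.inr ⟨hyj, fun hM => hy ?_⟩
        obtain ⟨F', hFF', hpw, hin, hout⟩ := hM
        refine ⟨F', (Finset.subset_insert _ _).trans hFF', hpw, fun t ht htF => ?_, hout⟩
        by_cases hts : t = s
        · subst hts
          exact ⟨not_lt.1 hε, (hsB y hyi).le⟩
        · exact hin t ht (by simp [hts, htF])
    have hmeas : μ (Metric.closedBall x ((p : ℝ) ^ (-(k + j)))) =
        p * μ (Metric.closedBall x ((p : ℝ) ^ (-(k + i)))) := by
      rw [measure_closedBall_eq_mul, hj]
      push_cast
      rw [add_assoc]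
    have hone : (1 : ENNReal) ≤ ((2 * p : ℕ) : ENNReal) ^ m := by
      refine one_le_pow₀ ?_
      have := hp.out.one_lt
      exact_mod_cast (by omega : 1 ≤ 2 * p)
    calc _ ≤ _ := measure_mono hsub
      _ ≤ _ := measure_union_le _ _
      _ ≤ _ := add_le_add h2 h1
      _ ≤ ((2 * p : ℕ) : ENNReal) ^ m * C * μ (Metric.closedBall x ((p : ℝ) ^ (-(k + j)))) +
          ((2 * p : ℕ) : ENNReal) ^ m * C * μ (Metric.closedBall x ((p : ℝ) ^ (-(k + j)))) := by
        gcongr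
        exact le_mul_of_one_le_left zero_le hone
      _ = _ := by
        rw [hmeas]
        push_cast
        ring

end Marking

end QuantNondiv
namespace QuantNondiv

section Good

lemma exists_separated_or_cover {X : Type*} [MetricSpace X] (E : Set X) {s : ℝ} (hs : 0 ≤ s)
    (d : ℕ) :
    (∃ T : Finset X, (T : Set X) ⊆ E ∧ T.card = d + 1 ∧
      (T : Set X).Pairwise fun x y => s < dist x y) ∨
    ∃ T : Finset X, T.card ≤ d ∧ E ⊆ ⋃ t ∈ T, Metric.closedBall t s := by
  classical
  induction d with
  | zero =>
    rcases E.eq_empty_or_nonempty with rfl | ⟨x, hx⟩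
    · exact Or.inr ⟨∅, by simp⟩
    · exact Or.inl ⟨{x}, by simpa using hx, by simp⟩
  | succ d ih =>
    rcases ih with ⟨T, hTE, hT, hsep⟩ | ⟨T, hT, hcov⟩
    · by_cases h : E ⊆ ⋃ t ∈ T, Metric.closedBall t s
      · exact Or.inr ⟨T, hT.le, h⟩
      · left
        obtain ⟨x, hx, hxT⟩ := Set.not_subset.1 h
        simp only [Set.mem_iUnion, Metric.mem_closedBall, not_exists, not_le] at hxT
        have hxn : x ∉ T := fun hmem => by
          have := hxT x hmem
          rw [dist_self] at this
          linarith
        refine ⟨insert x T, ?_, by rw [Finset.card_insert_of_notMem hxn, hT], ?_⟩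
        · rw [Finset.coe_insert]
          exact Set.insert_subset hx hTE
        · rw [Finset.coe_insert]
          exact hsep.insert fun t ht _ => ⟨hxT t ht, by rw [dist_comm]; exact hxT t ht⟩
    · exact Or.inr ⟨T, by omega, hcov⟩

variable {p : ℕ} [hp : Fact p.Prime]

lemma norm_eval_lt_of_separated {P : ℚ_[p][X]} {d : ℕ} (hP : P.natDegree ≤ d) {c y : ℚ_[p]}
    {R s ε : ℝ} (hs : 0 < s) (hR : 0 < R) {T : Finset ℚ_[p]} (hT : T.card = d + 1)
    (hTc : (T : Set ℚ_[p]) ⊆ {x ∈ Metric.closedBall c R | ‖P.eval x‖ < ε})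
    (hsep : (T : Set ℚ_[p]).Pairwise fun x y => s < dist x y) (hy : y ∈ Metric.closedBall c R) :
    ‖P.eval y‖ < ε * (R / s) ^ d := by
  classical
  have hdeg : P.degree < T.card := by
    rw [hT]
    exact lt_of_le_of_lt Polynomial.degree_le_natDegree (by exact_mod_cast Nat.lt_succ_of_le hP)
  have hinj : Set.InjOn (id : ℚ_[p] → ℚ_[p]) T := Function.injective_id.injOn
  have h := Lagrange.eq_interpolate (s := T) (v := id) hinj hdeg
  have hne : T.Nonempty := Finset.card_pos.1 (by omega)
  rw [Lagrange.interpolate_eq_sum] at h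
  rw [h, Polynomial.eval_finsetSum]
  obtain ⟨t, ht, hle⟩ := IsUltrametricDist.exists_norm_finsetSum_le_of_nonempty hne
    fun i => Polynomial.eval y (C (P.eval (id i) / ∏ j ∈ T.erase i, (id i - id j)) *
      ∏ j ∈ T.erase i, (X - C (id j)))
  refine hle.trans_lt ?_
  simp only [id, Polynomial.eval_mul, Polynomial.eval_C, Polynomial.eval_prod, Polynomial.eval_sub,
    Polynomial.eval_X, norm_mul, norm_div, norm_prod]
  have hcard : (T.erase t).card = d := by rw [Finset.card_erase_of_mem ht, hT]; rfl
  have hnum : ∏ j ∈ T.erase t, ‖y - j‖ ≤ R ^ d := by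
    rw [← hcard, ← Finset.prod_const]
    refine Finset.prod_le_prod (fun _ _ => norm_nonneg _) fun j hj => ?_
    have hj' := (hTc (Finset.mem_of_mem_erase hj)).1
    rw [IsUltrametricDist.closedBall_eq_of_mem hj', Metric.mem_closedBall, dist_eq_norm] at hy
    exact hy
  have hden : s ^ d ≤ ∏ j ∈ T.erase t, ‖t - j‖ := by
    rw [← hcard, ← Finset.prod_const]
    refine Finset.prod_le_prod (fun _ _ => hs.le) fun j hj => ?_
    rw [← dist_eq_norm]
    exact (hsep ht (Finset.mem_of_mem_erase hj) (Finset.ne_of_mem_erase hj).symm).le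
  have hval := (hTc ht).2
  have hden0 : 0 < ∏ j ∈ T.erase t, ‖t - j‖ := lt_of_lt_of_le (by positivity) hden
  calc ‖P.eval t‖ / (∏ j ∈ T.erase t, ‖t - j‖) * ∏ j ∈ T.erase t, ‖y - j‖
      ≤ ‖P.eval t‖ / s ^ d * R ^ d := by gcongr
    _ < ε / s ^ d * R ^ d := by gcongr
    _ = ε * (R / s) ^ d := by rw [div_pow]; ring

lemma polynomial_good (μ : Measure ℚ_[p]) [μ.IsAddHaarMeasure] {P : ℚ_[p][X]} {d : ℕ}
    (hd : d ≠ 0) (hP : P.natDegree ≤ d) {c y : ℚ_[p]} {k : ℤ} {ρ ε : ℝ} (hρ : 0 < ρ) (hε : 0 < ε)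
    (hy : y ∈ Metric.closedBall c ((p : ℝ) ^ (-k))) (hyρ : ρ ≤ ‖P.eval y‖) :
    μ {x ∈ Metric.closedBall c ((p : ℝ) ^ (-k)) | ‖P.eval x‖ < ε} ≤
      ENNReal.ofReal (d * p * (ε / ρ) ^ (d : ℝ)⁻¹) * μ (Metric.closedBall c ((p : ℝ) ^ (-k))) := by
  have hp1 : (1 : ℝ) < p := by exact_mod_cast hp.out.one_lt
  have hd1 : (1 : ℝ) ≤ d := by exact_mod_cast Nat.one_le_iff_ne_zero.2 hd
  set t : ℝ := (ε / ρ) ^ (d : ℝ)⁻¹ with ht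
  have htpos : 0 < t := by positivity
  have htd : t ^ d = ε / ρ := by
    rw [ht]; exact Real.rpow_inv_natCast_pow (by positivity) hd
  rcases le_or_gt 1 t with ht1 | ht1
  · refine (measure_mono fun x hx => hx.1).trans (le_mul_of_one_le_left zero_le ?_)
    rw [ENNReal.one_le_ofReal]
    calc (1 : ℝ) = 1 * 1 * 1 := by ring
      _ ≤ d * p * t := by gcongr
  obtain ⟨j, hj1, hj2⟩ := exists_nat_pow_near_of_lt_one htpos ht1.le (inv_pos.2 (by linarith))
    (inv_lt_one_of_one_lt₀ hp1)
  have hs : (p : ℝ) ^ (-(k + j)) = (p : ℝ) ^ (-k) * ((p : ℝ)⁻¹) ^ j := by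
    rw [neg_add, zpow_add₀ (by positivity), zpow_neg _ (j : ℤ), zpow_natCast, inv_pow]
  rcases exists_separated_or_cover
    {x ∈ Metric.closedBall c ((p : ℝ) ^ (-k)) | ‖P.eval x‖ < ε}
    (prime_zpow_pos (p := p) (-(k + j))).le d with ⟨T, hTE, hT, hsep⟩ | ⟨T, hT, hcov⟩
  · exfalso
    have h := norm_eval_lt_of_separated hP (prime_zpow_pos _) (prime_zpow_pos _) hT hTE hsep hy
    have hR := prime_zpow_pos (p := p) (-k)
    have h2 : ε * ((p : ℝ) ^ (-k) / (p : ℝ) ^ (-(k + j))) ^ d ≤ ρ := by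
      rw [hs, div_mul_eq_div_div, div_self hR.ne', one_div, inv_pow]
      have : ε / ρ ≤ (((p : ℝ)⁻¹) ^ j) ^ d := by
        rw [← htd]; gcongr
      rw [div_le_iff₀ hρ] at this
      rw [mul_inv_le_iff₀ (by positivity), mul_comm]
      exact this
    linarith
  · have hmeas := measure_closedBall_mul_pow μ c k j
    calc _ ≤ _ := measure_mono hcov
      _ ≤ ∑ x ∈ T, μ (Metric.closedBall x ((p : ℝ) ^ (-(k + j)))) := measure_biUnion_finset_le _ _
      _ = T.card * μ (Metric.closedBall c ((p : ℝ) ^ (-(k + j)))) := by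
        rw [Finset.sum_congr rfl fun x _ => measure_closedBall_translate μ x c _,
          Finset.sum_const, nsmul_eq_mul]
      _ ≤ d * μ (Metric.closedBall c ((p : ℝ) ^ (-(k + j)))) := by gcongr
      _ ≤ ENNReal.ofReal (d * p * t) *
          ((p : ENNReal) ^ j * μ (Metric.closedBall c ((p : ℝ) ^ (-(k + j))))) := by
        rw [← mul_assoc]
        gcongr
        rw [← ENNReal.ofReal_natCast, ← ENNReal.ofReal_natCast, ← ENNReal.ofReal_pow (by positivity),
          ← ENNReal.ofReal_mul (by positivity)]
        refine ENNReal.ofReal_le_ofReal ?_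
        have : 1 ≤ p * t * (p : ℝ) ^ j := by
          rw [inv_pow, inv_lt_iff_one_lt_mul₀ (by positivity)] at hj1
          rw [pow_succ] at hj1
          nlinarith
        nlinarith
      _ = _ := by rw [← hmeas]

end Good

end QuantNondiv
namespace QuantNondiv

section Jets

open Matrix

variable {K : Type*} [CommRing K] {n k : ℕ}

/-- The columns `I` of the matrix of Hasse derivatives at `x` of the polynomials whose coefficient
vectors are the rows of `A`. -/
def jet (A : Matrix (Fin k) (Fin (n + 1)) K) {l : ℕ} (I : Fin l → Fin (n + 1)) (x : K) :
    Matrix (Fin k) (Fin l) K :=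
  of fun b a => ∑ j : Fin (n + 1), ((j : ℕ).choose (I a) : K) * A b j * x ^ ((j : ℕ) - (I a : ℕ))

lemma jet_apply (A : Matrix (Fin k) (Fin (n + 1)) K) {l : ℕ} (I : Fin l → Fin (n + 1)) (x : K)
    (b : Fin k) (a : Fin l) : jet A I x b a =
      ∑ j : Fin (n + 1), ((j : ℕ).choose (I a) : K) * A b j * x ^ ((j : ℕ) - (I a : ℕ)) := rfl

lemma jet_mul {m : ℕ} (T : Matrix (Fin m) (Fin k) K) (A : Matrix (Fin k) (Fin (n + 1)) K) {l : ℕ}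
    (I : Fin l → Fin (n + 1)) (x : K) : jet (T * A) I x = T * jet A I x := by
  ext b a
  simp only [jet_apply, mul_apply, Finset.mul_sum, Finset.sum_mul]
  rw [Finset.sum_comm]
  refine Finset.sum_congr rfl fun i _ => Finset.sum_congr rfl fun j _ => ?_
  ring

lemma det_jet_eq_sum (A : Matrix (Fin k) (Fin (n + 1)) K) (I : Fin k → Fin (n + 1)) (x : K) :
    (jet A I x).det = ∑ f : Fin k → Fin (n + 1),
      (∏ a, (((f a : ℕ).choose (I a) : K) * x ^ ((f a : ℕ) - (I a : ℕ)))) *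
        (A.submatrix id f).det := by
  have h : (jet A I x)ᵀ = fun a => ∑ j : Fin (n + 1),
      (((j : ℕ).choose (I a) : K) * x ^ ((j : ℕ) - (I a : ℕ))) • (fun b => A b j) := by
    ext a b
    simp only [transpose_apply, jet_apply, Finset.sum_apply, Pi.smul_apply, smul_eq_mul]
    exact Finset.sum_congr rfl fun j _ => by ring
  rw [← det_transpose, h]
  have h2 := (detRowAlternating (n := Fin k) (R := K)).toMultilinearMap.map_sum
    (fun a (j : Fin (n + 1)) =>
      (((j : ℕ).choose (I a) : K) * x ^ ((j : ℕ) - (I a : ℕ))) • (fun b => A b j))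
  refine h2.trans (Finset.sum_congr rfl fun f _ => ?_)
  rw [MultilinearMap.map_smul_univ, smul_eq_mul]
  congr 1
  rw [← det_transpose (A.submatrix id f)]
  rfl

lemma sum_range_le_sum_of_injective {f : Fin k → ℕ} (hf : Function.Injective f) :
    ∑ i ∈ Finset.range k, i ≤ ∑ a, f a := by
  classical
  have hc : (Finset.univ.image f).card = k := by
    rw [Finset.card_image_of_injective _ hf, Finset.card_univ, Fintype.card_fin]
  have h1 : ∑ a, f a = ∑ i ∈ Finset.univ.image f, i := by
    rw [Finset.sum_image hf.injOn]
  have h2 : ∑ i ∈ Finset.univ.image f, i = ∑ j : Fin k, (Finset.univ.image f).orderEmbOfFin hc j := by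
    rw [← Finset.sum_image (f := fun i => i) (s := Finset.univ)
      (g := (Finset.univ.image f).orderEmbOfFin hc)
      ((Finset.univ.image f).orderEmbOfFin hc).injective.injOn, Finset.image_orderEmbOfFin_univ]
  rw [h1, h2, Finset.sum_range]
  refine Finset.sum_le_sum fun j _ => ?_
  have hmono := ((Finset.univ.image f).orderEmbOfFin hc).strictMono
  obtain ⟨j, hj⟩ := j
  induction j with
  | zero => exact Nat.zero_le _
  | succ j ih =>
    have := ih (by omega) (Finset.mem_univ _)
    have h3 := hmono (show (⟨j, by omega⟩ : Fin k) < ⟨j + 1, hj⟩ by simp)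
    simp only at this ⊢
    omega

lemma sum_sub_le_of_injective {f I : Fin k → Fin (n + 1)} (hf : Function.Injective f)
    (hI : Function.Injective I) (hle : ∀ a, I a ≤ f a) :
    ∑ a, ((f a : ℕ) - (I a : ℕ)) ≤ k * (n + 1 - k) := by
  have hk : k ≤ n + 1 := by simpa using Fintype.card_le_of_injective f hf
  have h1 := sum_range_le_sum_of_injective (f := fun a => (I a : ℕ)) (Fin.val_injective.comp hI)
  have h2 := sum_range_le_sum_of_injective (f := fun a => n - (f a : ℕ)) (fun a b hab => by
    apply hf; apply Fin.ext; simp only at hab; have := (f a).2; have := (f b).2; omega)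
  have h3 : ∑ a, ((f a : ℕ) - (I a : ℕ)) + ∑ a, (I a : ℕ) + ∑ a, (n - (f a : ℕ)) = k * n := by
    rw [← Finset.sum_add_distrib, ← Finset.sum_add_distrib]
    rw [Finset.sum_congr rfl (g := fun _ => n) fun a _ => by
      have := hle a; rw [Fin.le_def] at this; have := (f a).2; omega]
    simp
  have h4 := Finset.sum_range_id_mul_two k
  rcases k with _ | k
  · simp
  obtain ⟨m, rfl⟩ := Nat.exists_eq_add_of_le (show k ≤ n by omega)
  rw [show k + m + 1 - (k + 1) = m by omega]
  have h5 : (k + 1) * (k + m) = (∑ i ∈ Finset.range (k + 1), i) * 2 + (k + 1) * m := by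
    rw [h4, Nat.add_sub_cancel]; ring
  omega

lemma exists_polynomial_det_jet (A : Matrix (Fin k) (Fin (n + 1)) K) (I : Fin k → Fin (n + 1)) :
    ∃ P : K[X], P.natDegree ≤ k * (n + 1 - k) ∧ ∀ x, P.eval x = (jet A I x).det := by
  classical
  by_cases hI : Function.Injective I
  swap
  · refine ⟨0, by simp, fun x => ?_⟩
    rw [Polynomial.eval_zero]
    obtain ⟨a, b, hab, hne⟩ : ∃ a b, I a = I b ∧ a ≠ b := by
      simpa [Function.Injective, and_comm] using hI
    exact (det_zero_of_column_eq hne fun c => by simp only [jet_apply, hab]).symm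
  refine ⟨∑ f : Fin k → Fin (n + 1), (∏ a, (C ((f a : ℕ).choose (I a) : K) *
    X ^ ((f a : ℕ) - (I a : ℕ)))) * C (A.submatrix id f).det, ?_, fun x => ?_⟩
  · refine Polynomial.natDegree_sum_le_of_forall_le _ _ fun f _ => ?_
    by_cases hf : Function.Injective f
    swap
    · obtain ⟨a, b, hab, hne⟩ : ∃ a b, f a = f b ∧ a ≠ b := by
        simpa [Function.Injective, and_comm] using hf
      rw [det_zero_of_column_eq hne fun c => by simp [hab]]
      simp
    by_cases hle : ∀ a, I a ≤ f a
    swap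
    · push Not at hle
      obtain ⟨a, ha⟩ := hle
      rw [Finset.prod_eq_zero (Finset.mem_univ a)]
      · simp
      · rw [Nat.choose_eq_zero_of_lt (by simpa using ha)]
        simp
    refine (Polynomial.natDegree_mul_C_le _ _).trans ?_
    refine (Polynomial.natDegree_prod_le _ _).trans ?_
    refine (Finset.sum_le_sum fun a _ => Polynomial.natDegree_C_mul_X_pow_le _ _).trans ?_
    exact sum_sub_le_of_injective hf hI hle
  · rw [det_jet_eq_sum, Polynomial.eval_finsetSum]
    simp [Polynomial.eval_prod]

end Jets

end QuantNondiv
namespace QuantNondiv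

section Wronskian

open Matrix

variable {K : Type*} {n k : ℕ}

lemma det_choose_ne_zero [Field K] [CharZero K] {d : Fin k → ℕ} (hd : Function.Injective d) :
    (of fun b a : Fin k => ((d b).choose a : K)).det ≠ 0 := by
  have h1 := det_eval_matrixOfPolynomials_eq_det_vandermonde (fun b => (d b : K))
    (fun a : Fin k => descPochhammer K a) (fun a => descPochhammer_natDegree K a)
    (fun a => monic_descPochhammer K a)
  have h2 : (of fun b a : Fin k => (descPochhammer K a).eval (d b : K)) =
      of fun b a : Fin k => ((a : ℕ).factorial : K) *
        (of fun b a : Fin k => ((d b).choose a : K)) b a := by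
    ext b a
    simp only [of_apply]
    rw [descPochhammer_eval_eq_descFactorial, Nat.descFactorial_eq_factorial_mul_choose]
    push_cast
    ring
  rw [h2, det_mul_row] at h1
  intro h0
  rw [h0, mul_zero] at h1
  exact det_vandermonde_ne_zero_iff.2 (Nat.cast_injective.comp hd) h1

/-- The first `k` indices among `n + 1`. -/
def firstCols (hk : k ≤ n + 1) : Fin k → Fin (n + 1) := Fin.castLE hk

lemma det_jet_X_ne_zero_of_distinct_degrees [Field K] [CharZero K] (hk : k ≤ n + 1)
    (g : Matrix (Fin k) (Fin (n + 1)) K) {d : Fin k → Fin (n + 1)} (hd : Function.Injective d)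
    (hg : ∀ b, g b (d b) ≠ 0) (hg0 : ∀ b j, d b < j → g b j = 0) :
    (jet (g.map C) (firstCols hk) (X : K[X])).det ≠ 0 := by
  set W := jet (g.map C) (firstCols hk) (X : K[X]) with hW
  set M : Matrix (Fin k) (Fin k) K[X] :=
    of fun b a => X ^ (a : ℕ) * (of fun b a => X ^ (n - (d b : ℕ)) * W b a) b a with hM
  have hdetM : M.det = (∏ a : Fin k, X ^ (a : ℕ)) * ((∏ b, X ^ (n - (d b : ℕ))) * W.det) := by
    rw [hM, det_mul_row, det_mul_column]
  have hentry : ∀ b a, M b a = ∑ j : Fin (n + 1),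
      C (((j : ℕ).choose a : K) * g b j) * X ^ (n - (d b : ℕ) + j) := by
    intro b a
    simp only [hM, of_apply, hW, jet_apply, Finset.mul_sum]
    refine Finset.sum_congr rfl fun j _ => ?_
    change X ^ (a : ℕ) * (X ^ (n - (d b : ℕ)) *
      (((j : ℕ).choose (a : ℕ) : K[X]) * C (g b j) * X ^ ((j : ℕ) - (a : ℕ)))) = _
    rcases lt_or_ge (j : ℕ) a with h | h
    · rw [Nat.choose_eq_zero_of_lt h]; simp
    · obtain ⟨e, he⟩ := Nat.exists_eq_add_of_le h
      rw [he, Nat.add_sub_cancel_left, pow_add, pow_add, C_mul, C_eq_natCast]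
      ring
  have hdeg : ∀ b a, (M b a).natDegree ≤ n := by
    intro b a
    rw [hentry]
    refine natDegree_sum_le_of_forall_le _ _ fun j _ => ?_
    rcases lt_or_ge (d b) j with h | h
    · rw [hg0 b j h]; simp
    · refine (natDegree_C_mul_X_pow_le _ _).trans ?_
      have := (d b).2
      rw [Fin.le_def] at h
      omega
  have hcoeff : ∀ b a, (M b a).coeff n = ((d b : ℕ).choose a : K) * g b (d b) := by
    intro b a
    rw [hentry, finsetSum_coeff, Finset.sum_eq_single (d b)]
    · rw [coeff_C_mul_X_pow, if_pos]
      have := (d b).2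
      omega
    · intro j _ hj
      rw [coeff_C_mul_X_pow, if_neg]
      intro h
      apply hj
      apply Fin.ext
      have := (d b).2
      omega
    · simp
  have hc : M.det.coeff (k * n) =
      (of fun b a => g b (d b) * (of fun b a : Fin k => ((d b : ℕ).choose a : K)) b a).det := by
    rw [det_apply, det_apply, finsetSum_coeff]
    refine Finset.sum_congr rfl fun σ _ => ?_
    rw [Units.smul_def, Units.smul_def, coeff_smul]
    congr 1
    have := coeff_prod_of_natDegree_le (s := Finset.univ) (fun i : Fin k => M (σ i) i) n
      (fun i _ => hdeg _ _)
    rw [Finset.card_univ, Fintype.card_fin] at this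
    rw [this]
    refine Finset.prod_congr rfl fun i _ => ?_
    rw [hcoeff, of_apply, of_apply, mul_comm]
  intro h0
  rw [hdetM, h0, mul_zero, mul_zero, coeff_zero, det_mul_column] at hc
  exact mul_ne_zero (Finset.prod_ne_zero_iff.2 fun b _ => hg b)
    (det_choose_ne_zero (Fin.val_injective.comp hd)) hc.symm

lemma exists_distinct_degrees [Field K] (A : Matrix (Fin k) (Fin (n + 1)) K)
    (hA : ∀ c : Fin k → K, c ᵥ* A = 0 → c = 0) :
    ∃ (T : Matrix (Fin k) (Fin k) K) (d : Fin k → Fin (n + 1)), Function.Injective d ∧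
      (∀ b, (T * A) b (d b) ≠ 0) ∧ ∀ b j, d b < j → (T * A) b j = 0 := by
  classical
  set D : Finset (Fin (n + 1)) := Finset.univ.filter fun d =>
    ∃ c : Fin k → K, (c ᵥ* A) d ≠ 0 ∧ ∀ j, d < j → (c ᵥ* A) j = 0 with hD
  have hcard : k ≤ D.card := by
    by_contra! hlt
    let L : (Fin k → K) →ₗ[K] (D → K) :=
      (LinearMap.funLeft K K (fun d : D => (d : Fin (n + 1)))).comp A.vecMulLinear
    have hker := LinearMap.ker_ne_bot_of_finrank_lt (f := L) (by simpa using hlt)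
    obtain ⟨c, hc, hc0⟩ := (Submodule.ne_bot_iff _).1 hker
    have hne : c ᵥ* A ≠ 0 := fun h => hc0 (hA c h)
    obtain ⟨j0, hj0⟩ := Function.ne_iff.1 hne
    obtain ⟨d, hd, hmax⟩ := Finset.exists_max_image
      (Finset.univ.filter fun j => (c ᵥ* A) j ≠ 0) id ⟨j0, by simpa using hj0⟩
    have hd' : (c ᵥ* A) d ≠ 0 := (Finset.mem_filter.1 hd).2
    have hdD : d ∈ D := by
      refine Finset.mem_filter.2 ⟨Finset.mem_univ _, c, hd', fun j hj => ?_⟩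
      by_contra hne'
      exact absurd (hmax j (by simpa using hne')) (not_le.2 hj)
    exact hd' (congrFun (LinearMap.mem_ker.1 hc) ⟨d, hdD⟩)
  obtain ⟨e⟩ : Nonempty (Fin k ↪ D) :=
    Function.Embedding.nonempty_of_card_le (by simpa using hcard)
  have hch : ∀ b, ∃ c : Fin k → K, (c ᵥ* A) (e b) ≠ 0 ∧ ∀ j, (e b : Fin (n + 1)) < j →
      (c ᵥ* A) j = 0 := fun b => (Finset.mem_filter.1 (e b).2).2
  choose T hT hT0 using hch
  exact ⟨of T, fun b => e b, Subtype.val_injective.comp e.injective, fun b => hT b,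
    fun b j hj => hT0 b j hj⟩

lemma exists_det_jet_ne_zero [Field K] [CharZero K] (hk : k ≤ n + 1)
    (A : Matrix (Fin k) (Fin (n + 1)) K) (hA : ∀ c : Fin k → K, c ᵥ* A = 0 → c = 0)
    {s : Set K} (hs : s.Infinite) : ∃ x ∈ s, (jet A (firstCols hk) x).det ≠ 0 := by
  obtain ⟨T, d, hd, hg, hg0⟩ := exists_distinct_degrees A hA
  have h := det_jet_X_ne_zero_of_distinct_degrees hk (T * A) hd hg hg0
  rw [Matrix.map_mul, jet_mul, det_mul] at h
  have h' := right_ne_zero_of_mul h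
  by_contra! hz
  apply h'
  refine Polynomial.eq_zero_of_infinite_isRoot _ (hs.mono fun x hx => ?_)
  rw [Set.mem_ofPred_eq, IsRoot.def, ← hz x hx, ← coe_evalRingHom, RingHom.map_det]
  congr 1
  ext b a
  simp [jet_apply, eval_finsetSum]

end Wronskian

end QuantNondiv
namespace QuantNondiv

section JetLowerBound

open Matrix

variable {p : ℕ} [hp : Fact p.Prime] {n k : ℕ}

lemma continuous_jet_det (I : Fin k → Fin (n + 1)) (x : ℚ_[p]) :
    Continuous fun A : Matrix (Fin k) (Fin (n + 1)) ℚ_[p] => (jet A I x).det := by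
  refine Continuous.matrix_det ?_
  refine continuous_matrix fun b a => ?_
  simp only [jet_apply]
  fun_prop

lemma exists_jet_lower_bound_of_normalized (hk : k ≤ n + 1) (c : ℚ_[p]) {r : ℝ} (hr : 0 < r)
    (J : Fin k → Fin (n + 1)) :
    ∃ κ : ℝ, 0 < κ ∧ ∀ A : Matrix (Fin k) (Fin (n + 1)) ℚ_[p], (∀ b j, ‖A b j‖ ≤ 1) →
      A.submatrix id J = 1 →
      ∃ x ∈ Metric.closedBall c r, κ ≤ ‖(jet A (firstCols hk) x).det‖ := by
  set S : Set (Matrix (Fin k) (Fin (n + 1)) ℚ_[p]) :=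
    {A | (∀ b j, ‖A b j‖ ≤ 1) ∧ A.submatrix id J = 1} with hS
  have hcomp : IsCompact S := by
    have h1 : IsCompact (Set.univ.pi fun _ : Fin k => Set.univ.pi fun _ : Fin (n + 1) =>
        Metric.closedBall (0 : ℚ_[p]) 1) :=
      isCompact_univ_pi fun _ => isCompact_univ_pi fun _ => isCompact_closedBall _ _
    have h2 : IsClosed {A : Matrix (Fin k) (Fin (n + 1)) ℚ_[p] | A.submatrix id J = 1} :=
      isClosed_eq (continuous_id.matrix_submatrix _ _) continuous_const
    have h3 := h1.inter_right h2
    refine h3.of_isClosed_subset ?_ fun A hA => ⟨?_, hA.2⟩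
    · have h4 : S = (⋂ b, ⋂ j, {A : Matrix (Fin k) (Fin (n + 1)) ℚ_[p] | ‖A b j‖ ≤ 1}) ∩
          {A | A.submatrix id J = 1} := by
        ext A
        simp [hS]
      rw [h4]
      exact (isClosed_iInter fun b => isClosed_iInter fun j =>
        isClosed_le (continuous_id.matrix_elem b j).norm continuous_const).inter h2
    · exact fun b _ j _ => mem_closedBall_zero_iff.2 (hA.1 b j)
  have hinf : (Metric.closedBall c r).Infinite :=
    infinite_of_mem_nhds c (Metric.closedBall_mem_nhds c hr)
  have key : ∃ κ : ℝ, 0 < κ ∧ ∀ A ∈ S,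
      ∃ x ∈ Metric.closedBall c r, κ ≤ ‖(jet A (firstCols hk) x).det‖ := by
    refine hcomp.induction_on (p := fun s => ∃ κ : ℝ, 0 < κ ∧ ∀ A ∈ s,
      ∃ x ∈ Metric.closedBall c r, κ ≤ ‖(jet A (firstCols hk) x).det‖) ?_ ?_ ?_ ?_
    · exact ⟨1, one_pos, by simp⟩
    · rintro s t hst ⟨κ, hκ, h⟩
      exact ⟨κ, hκ, fun A hA => h A (hst hA)⟩
    · rintro s t ⟨κ, hκ, h⟩ ⟨κ', hκ', h'⟩
      refine ⟨min κ κ', lt_min hκ hκ', ?_⟩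
      rintro A (hA | hA)
      · obtain ⟨x, hx, hle⟩ := h A hA
        exact ⟨x, hx, (min_le_left _ _).trans hle⟩
      · obtain ⟨x, hx, hle⟩ := h' A hA
        exact ⟨x, hx, (min_le_right _ _).trans hle⟩
    · rintro A ⟨_, hA⟩
      obtain ⟨x, hx, hne⟩ := exists_det_jet_ne_zero hk A (fun u hu => by
        have : u ᵥ* A.submatrix id J = 0 := funext fun a => congrFun hu (J a)
        rwa [hA, vecMul_one] at this) hinf
      have hpos := norm_pos_iff.2 hne
      refine ⟨{A' | ‖(jet A (firstCols hk) x).det‖ / 2 < ‖(jet A' (firstCols hk) x).det‖},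
        mem_nhdsWithin_of_mem_nhds ?_, _, half_pos hpos, fun A' hA' => ⟨x, hx, le_of_lt hA'⟩⟩
      exact (isOpen_lt continuous_const (continuous_jet_det _ x).norm).mem_nhds (half_lt_self hpos)
  obtain ⟨κ, hκ, h⟩ := key
  exact ⟨κ, hκ, fun A h1 h2 => h A ⟨h1, h2⟩⟩

/-- The supremum over a ball of the leading jet minor dominates the maximal minor of the coefficient
matrix, up to a constant depending only on the ball. -/
theorem exists_jet_lower_bound (hk : k ≤ n + 1) (c : ℚ_[p]) {r : ℝ} (hr : 0 < r) :
    ∃ κ : ℝ, 0 < κ ∧ ∀ (A : Matrix (Fin k) (Fin (n + 1)) ℚ_[p]) (J : Fin k → Fin (n + 1)),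
      (∀ J' : Fin k → Fin (n + 1), ‖(A.submatrix id J').det‖ ≤ ‖(A.submatrix id J).det‖) →
      ∃ x ∈ Metric.closedBall c r,
        κ * ‖(A.submatrix id J).det‖ ≤ ‖(jet A (firstCols hk) x).det‖ := by
  choose κ hκ h using exists_jet_lower_bound_of_normalized (p := p) hk c hr
  obtain ⟨J₀, hJ₀⟩ := Finite.exists_min κ
  refine ⟨κ J₀, hκ J₀, fun A J hmax => ?_⟩
  by_cases h0 : (A.submatrix id J).det = 0
  · exact ⟨c, Metric.mem_closedBall_self hr.le, by simp [h0]⟩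
  set T := A.submatrix id J with hT
  have hu : IsUnit T.det := isUnit_iff_ne_zero.2 h0
  set B := T⁻¹ * A with hB
  have hTB : T * B = A := by rw [hB, mul_nonsing_inv_cancel_left _ _ hu]
  have hsub : ∀ J' : Fin k → Fin (n + 1), A.submatrix id J' = T * B.submatrix id J' := by
    intro J'
    rw [← hTB]; rfl
  have hBJ : B.submatrix id J = 1 := by
    have : B.submatrix id J = T⁻¹ * T := rfl
    rw [this, nonsing_inv_mul _ hu]
  have hentry : ∀ b j, ‖B b j‖ ≤ 1 := by
    intro b j
    have h1 : B.submatrix id (Function.update J b j) =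
        (1 : Matrix (Fin k) (Fin k) ℚ_[p]).updateCol b (fun i => B i j) := by
      ext i a
      rw [← hBJ]
      by_cases hab : a = b
      · subst hab; simp
      · simp [hab]
    have h2 : (B.submatrix id (Function.update J b j)).det = B b j := by
      rw [h1, ← cramer_apply, cramer_one]; rfl
    have h3 := hmax (Function.update J b j)
    rw [hsub, det_mul, h2, norm_mul] at h3
    exact le_of_mul_le_mul_left (by simpa using h3) (norm_pos_iff.2 h0)
  obtain ⟨x, hx, hle⟩ := h J B hentry hBJ
  refine ⟨x, hx, ?_⟩
  rw [← hTB, jet_mul, det_mul, norm_mul, mul_comm]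
  exact mul_le_mul_of_nonneg_left ((hJ₀ J).trans hle) (norm_nonneg _)

end JetLowerBound

end QuantNondiv
namespace QuantNondiv

section Covolume

open Matrix

variable {p : ℕ} [hp : Fact p.Prime] {n k : ℕ}

/-- The weighted maximum of the `p`-adic norms of the `k × k` minors of the jet of `A` at `x`. -/
noncomputable def jetNorm (w : Fin (n + 1) → ℝ) (A : Matrix (Fin k) (Fin (n + 1)) ℤ) (x : ℚ_[p]) : ℝ :=
  ⨆ I : Fin k → Fin (n + 1),
    (∏ i, w (I i)) * ‖(jet (A.map (Int.castRingHom ℚ_[p])) I x).det‖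

/-- The maximum of the absolute values of the `k × k` minors of `A`. -/
noncomputable def height (A : Matrix (Fin k) (Fin (n + 1)) ℤ) : ℝ :=
  ⨆ J : Fin k → Fin (n + 1), |((A.submatrix id J).det : ℝ)|

/-- The product of the `p`-adic and real sizes of the `ℤ`-span of the rows of `A`. -/
noncomputable def covol (w : Fin (n + 1) → ℝ) (H : ℝ) (A : Matrix (Fin k) (Fin (n + 1)) ℤ) (x : ℚ_[p]) : ℝ :=
  jetNorm w A x * (height A / H ^ k)

variable {w : Fin (n + 1) → ℝ} {H : ℝ}

lemma le_jetNorm (A : Matrix (Fin k) (Fin (n + 1)) ℤ) (x : ℚ_[p]) (I : Fin k → Fin (n + 1)) :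
    (∏ i, w (I i)) * ‖(jet (A.map (Int.castRingHom ℚ_[p])) I x).det‖ ≤ jetNorm w A x :=
  le_ciSup (f := fun I : Fin k → Fin (n + 1) =>
    (∏ i, w (I i)) * ‖(jet (A.map (Int.castRingHom ℚ_[p])) I x).det‖)
    (Set.finite_range _).bddAbove I

lemma le_height (A : Matrix (Fin k) (Fin (n + 1)) ℤ) (J : Fin k → Fin (n + 1)) :
    |((A.submatrix id J).det : ℝ)| ≤ height A :=
  le_ciSup (f := fun J : Fin k → Fin (n + 1) => |((A.submatrix id J).det : ℝ)|)
    (Set.finite_range _).bddAbove J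

lemma height_nonneg (A : Matrix (Fin k) (Fin (n + 1)) ℤ) : 0 ≤ height A :=
  Real.iSup_nonneg fun _ => abs_nonneg _

lemma jetNorm_nonneg (hw : ∀ i, 0 ≤ w i) (A : Matrix (Fin k) (Fin (n + 1)) ℤ) (x : ℚ_[p]) :
    0 ≤ jetNorm w A x :=
  Real.iSup_nonneg fun I => mul_nonneg (Finset.prod_nonneg fun i _ => hw (I i)) (norm_nonneg _)

lemma covol_of_isEmpty (A : Matrix (Fin 0) (Fin (n + 1)) ℤ) (x : ℚ_[p]) : covol w H A x = 1 := by
  simp [covol, jetNorm, height]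

lemma continuous_covol (A : Matrix (Fin k) (Fin (n + 1)) ℤ) :
    Continuous fun x : ℚ_[p] => covol w H A x := by
  unfold covol jetNorm
  refine Continuous.mul ?_ continuous_const
  have h : ∀ x : ℚ_[p], (⨆ I : Fin k → Fin (n + 1),
      (∏ i, w (I i)) * ‖(jet (A.map (Int.castRingHom ℚ_[p])) I x).det‖) =
      Finset.univ.sup' Finset.univ_nonempty fun I : Fin k → Fin (n + 1) =>
      (∏ i, w (I i)) * ‖(jet (A.map (Int.castRingHom ℚ_[p])) I x).det‖ :=
    fun x => (Finset.sup'_univ_eq_ciSup _).symm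
  simp only [h]
  refine Continuous.finset_sup'_apply _ fun I _ => ?_
  refine continuous_const.mul (Continuous.norm (Continuous.matrix_det ?_))
  refine continuous_matrix fun b a => ?_
  simp only [jet_apply]
  fun_prop

lemma covol_good (μ : Measure ℚ_[p]) [μ.IsAddHaarMeasure] (hw : ∀ i, 0 ≤ w i) (hH : 0 ≤ H)
    (A : Matrix (Fin k) (Fin (n + 1)) ℤ) {d : ℕ} (hd : d ≠ 0) (hkd : k * (n + 1 - k) ≤ d)
    {ε : ℝ} (hε : 0 < ε) (c : ℚ_[p]) (m : ℤ)
    (h : ∃ y ∈ Metric.closedBall c ((p : ℝ) ^ (-m)), 1 ≤ covol w H A y) :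
    μ {x ∈ Metric.closedBall c ((p : ℝ) ^ (-m)) | covol w H A x < ε} ≤
      ENNReal.ofReal (d * p * ε ^ (d : ℝ)⁻¹) * μ (Metric.closedBall c ((p : ℝ) ^ (-m))) := by
  obtain ⟨y, hy, h1⟩ := h
  obtain ⟨I, hI⟩ := exists_eq_ciSup_of_finite (f := fun I : Fin k → Fin (n + 1) =>
    (∏ i, w (I i)) * ‖(jet (A.map (Int.castRingHom ℚ_[p])) I y).det‖)
  obtain ⟨P, hP, hPe⟩ := exists_polynomial_det_jet (A.map (Int.castRingHom ℚ_[p])) I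
  have ht : 0 ≤ height A / H ^ k := div_nonneg (height_nonneg A) (pow_nonneg hH k)
  have hs0 : 0 ≤ (∏ i, w (I i)) * (height A / H ^ k) :=
    mul_nonneg (Finset.prod_nonneg fun i _ => hw _) ht
  set s := (∏ i, w (I i)) * (height A / H ^ k) with hs
  have hle : ∀ x, s * ‖P.eval x‖ ≤ covol w H A x := by
    intro x
    rw [hPe, covol, hs, mul_right_comm]
    exact mul_le_mul_of_nonneg_right (le_jetNorm A x I) ht
  have heq : covol w H A y = s * ‖P.eval y‖ := by
    rw [hPe, covol, jetNorm, ← hI, hs, mul_right_comm]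
  have hspos : 0 < s := by
    refine lt_of_le_of_ne hs0 fun h0 => ?_
    rw [heq, ← h0, zero_mul] at h1
    exact absurd h1 (by norm_num)
  have := polynomial_good μ hd (hP.trans hkd) (ρ := s⁻¹) (ε := ε / s) (inv_pos.2 hspos)
    (div_pos hε hspos) hy (by rw [inv_le_iff_one_le_mul₀' hspos, ← heq]; exact h1)
  rw [show ε / s / s⁻¹ = ε by field_simp] at this
  refine (measure_mono ?_).trans this
  rintro x ⟨hx, hlt⟩
  refine ⟨hx, ?_⟩
  rw [lt_div_iff₀' hspos]
  exact (hle x).trans_lt hlt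

lemma one_le_norm_mul_abs {m : ℤ} (hm : m ≠ 0) : 1 ≤ ‖(m : ℚ_[p])‖ * |(m : ℝ)| := by
  have h0 : (m : ℚ_[p]) ≠ 0 := Int.cast_ne_zero.2 hm
  have h1 : ((p : ℤ) ^ padicValInt p m) ∣ m := padicValInt_dvd m
  have h2 : ((p : ℤ) ^ padicValInt p m) ≤ |m| := Int.le_of_dvd (abs_pos.2 hm) ((dvd_abs _ _).2 h1)
  have h3 : ((p : ℝ) ^ padicValInt p m) ≤ |(m : ℝ)| := by exact_mod_cast h2
  have hpp : (0 : ℝ) < p := by exact_mod_cast hp.out.pos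
  rw [Padic.norm_eq_zpow_neg_valuation h0, Padic.valuation_intCast, _root_.zpow_neg, zpow_natCast,
    ← div_eq_inv_mul, one_le_div (pow_pos hpp _)]
  exact h3

lemma covol_le_covol_mul (hw : ∀ i, 0 ≤ w i) (hH : 0 ≤ H) (A : Matrix (Fin k) (Fin (n + 1)) ℤ)
    {T : Matrix (Fin k) (Fin k) ℤ} (hT : T.det ≠ 0) (x : ℚ_[p]) :
    covol w H A x ≤ covol w H (T * A) x := by
  have h1 : jetNorm w (T * A) x = ‖(T.det : ℚ_[p])‖ * jetNorm w A x := by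
    rw [jetNorm, jetNorm, Real.mul_iSup_of_nonneg (norm_nonneg _)]
    refine congrArg _ (funext fun I => ?_)
    rw [Matrix.map_mul, jet_mul, det_mul, norm_mul]
    have : (T.map (Int.castRingHom ℚ_[p])).det = (T.det : ℚ_[p]) :=
      ((Int.castRingHom ℚ_[p]).map_det T).symm
    rw [this]
    ring
  have h2 : height (T * A) = |(T.det : ℝ)| * height A := by
    rw [height, height, Real.mul_iSup_of_nonneg (abs_nonneg _)]
    refine congrArg _ (funext fun J => ?_)
    have : (T * A).submatrix id J = T * A.submatrix id J := rfl
    rw [this, det_mul, Int.cast_mul, abs_mul]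
  have h3 : covol w H (T * A) x = (‖(T.det : ℚ_[p])‖ * |(T.det : ℝ)|) * covol w H A x := by
    rw [covol, covol, h1, h2]; ring
  rw [h3]
  exact le_mul_of_one_le_left (mul_nonneg (jetNorm_nonneg hw A x)
    (div_nonneg (height_nonneg A) (pow_nonneg hH k))) (one_le_norm_mul_abs hT)

/-- The size of a single vector. -/
noncomputable def vecSize (w : Fin (n + 1) → ℝ) (H : ℝ) (a : Fin (n + 1) → ℤ) (x : ℚ_[p]) : ℝ :=
  (⨆ i : Fin (n + 1), w i * ‖∑ j : Fin (n + 1),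
    (((j : ℕ).choose (i : ℕ) : ℚ_[p]) * (a j : ℚ_[p]) * x ^ ((j : ℕ) - (i : ℕ)))‖) *
    (⨆ j : Fin (n + 1), |(a j : ℝ)| / H)

lemma jetNorm_vecCons_le (hw : ∀ i, 0 ≤ w i) (a : Fin (n + 1) → ℤ)
    (A : Matrix (Fin k) (Fin (n + 1)) ℤ) (x : ℚ_[p]) :
    jetNorm w (of (vecCons a A)) x ≤ (⨆ i : Fin (n + 1), w i * ‖∑ j : Fin (n + 1),
      (((j : ℕ).choose (i : ℕ) : ℚ_[p]) * (a j : ℚ_[p]) * x ^ ((j : ℕ) - (i : ℕ)))‖) *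
      jetNorm w A x := by
  set N : ℝ := ⨆ i : Fin (n + 1), w i * ‖∑ j : Fin (n + 1),
      (((j : ℕ).choose (i : ℕ) : ℚ_[p]) * (a j : ℚ_[p]) * x ^ ((j : ℕ) - (i : ℕ)))‖ with hN
  have hN0 : 0 ≤ N := Real.iSup_nonneg fun i => mul_nonneg (hw i) (norm_nonneg _)
  refine ciSup_le fun I => ?_
  rw [det_succ_row_zero]
  obtain ⟨l, -, hl⟩ := IsUltrametricDist.exists_norm_finsetSum_le_of_nonempty
    (t := Finset.univ) (Finset.univ_nonempty (α := Fin (k + 1)))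
    (fun l : Fin (k + 1) => (-1) ^ (l : ℕ) *
      jet ((of (vecCons a A)).map (Int.castRingHom ℚ_[p])) I x 0 l *
      ((jet ((of (vecCons a A)).map (Int.castRingHom ℚ_[p])) I x).submatrix
        Fin.succ l.succAbove).det)
  refine (mul_le_mul_of_nonneg_left hl (Finset.prod_nonneg fun i _ => hw (I i))).trans ?_
  have h1 : (jet ((of (vecCons a A)).map (Int.castRingHom ℚ_[p])) I x).submatrix
      Fin.succ l.succAbove = jet (A.map (Int.castRingHom ℚ_[p])) (fun i => I (l.succAbove i)) x := rfl
  have h2 : jet ((of (vecCons a A)).map (Int.castRingHom ℚ_[p])) I x 0 l = ∑ j : Fin (n + 1),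
      (((j : ℕ).choose (I l : ℕ) : ℚ_[p]) * (a j : ℚ_[p]) * x ^ ((j : ℕ) - (I l : ℕ))) := rfl
  rw [h1, h2, norm_mul, norm_mul, norm_pow, norm_neg, norm_one, one_pow, one_mul,
    Fin.prod_univ_succAbove _ l]
  have h3 : w (I l) * ‖∑ j : Fin (n + 1), (((j : ℕ).choose (I l : ℕ) : ℚ_[p]) * (a j : ℚ_[p]) *
      x ^ ((j : ℕ) - (I l : ℕ)))‖ ≤ N :=
    le_ciSup (f := fun i : Fin (n + 1) => w i * ‖∑ j : Fin (n + 1),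
      (((j : ℕ).choose (i : ℕ) : ℚ_[p]) * (a j : ℚ_[p]) * x ^ ((j : ℕ) - (i : ℕ)))‖)
      (Set.finite_range _).bddAbove (I l)
  have h4 := le_jetNorm (w := w) A x fun i => I (l.succAbove i)
  rw [mul_mul_mul_comm]
  exact mul_le_mul h3 h4 (mul_nonneg (Finset.prod_nonneg fun i _ => hw _) (norm_nonneg _)) hN0

lemma height_vecCons_le (a : Fin (n + 1) → ℤ) (A : Matrix (Fin k) (Fin (n + 1)) ℤ) :
    height (of (vecCons a A)) ≤ (k + 1) * (⨆ j, |(a j : ℝ)|) * height A := by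
  refine ciSup_le fun J => ?_
  rw [det_succ_row_zero, Int.cast_sum]
  refine (Finset.abs_sum_le_sum_abs _ _).trans ?_
  have h : ∀ l ∈ (Finset.univ : Finset (Fin (k + 1))),
      |(((-1) ^ (l : ℕ) * (of (vecCons a A)).submatrix id J 0 l *
        (((of (vecCons a A)).submatrix id J).submatrix Fin.succ l.succAbove).det : ℤ) : ℝ)| ≤
      (⨆ j, |(a j : ℝ)|) * height A := by
    intro l _
    have h1 : ((of (vecCons a A)).submatrix id J).submatrix Fin.succ l.succAbove =
      A.submatrix id fun i => J (l.succAbove i) := rfl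
    have h2 : (of (vecCons a A)).submatrix id J 0 l = a (J l) := rfl
    rw [h1, h2]
    rw [Int.cast_mul, Int.cast_mul, Int.cast_pow, Int.cast_neg, Int.cast_one, abs_mul, abs_mul,
      abs_pow, abs_neg, abs_one, one_pow, one_mul]
    have h5 : |(a (J l) : ℝ)| ≤ ⨆ j, |(a j : ℝ)| :=
      le_ciSup (f := fun j => |(a j : ℝ)|) (Set.finite_range _).bddAbove (J l)
    exact mul_le_mul h5 (le_height A _) (abs_nonneg _) ((abs_nonneg _).trans h5)
  refine (Finset.sum_le_sum h).trans_eq ?_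
  simp only [Finset.sum_const, Finset.card_univ, Fintype.card_fin, nsmul_eq_mul]
  push_cast
  ring

lemma covol_vecCons_le (hw : ∀ i, 0 ≤ w i) (hH : 0 < H) (a : Fin (n + 1) → ℤ)
    (A : Matrix (Fin k) (Fin (n + 1)) ℤ) (x : ℚ_[p]) :
    covol w H (of (vecCons a A)) x ≤ (k + 1) * covol w H A x * vecSize w H a x := by
  have h1 : (⨆ j, |(a j : ℝ)| / H) = (⨆ j, |(a j : ℝ)|) / H := by
    simp only [div_eq_mul_inv]
    rw [Real.iSup_mul_of_nonneg (inv_nonneg.2 hH.le)]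
  rw [covol, covol, vecSize, h1]
  have h2 := jetNorm_vecCons_le hw a A x
  refine (mul_le_mul h2 (div_le_div_of_nonneg_right (height_vecCons_le a A) (pow_nonneg hH.le _))
    (div_nonneg (height_nonneg _) (pow_nonneg hH.le _))
    ((jetNorm_nonneg hw _ x).trans h2)).trans_eq ?_
  rw [pow_succ]
  field_simp

end Covolume

end QuantNondiv
namespace QuantNondiv

section LowerBound

open Matrix

lemma prod_weights_mul_pow_le {n k : ℕ} (hk0 : k ≠ 0) (hkn : k ≤ n) {v Q : ℝ} (hv : v ≤ 1)
    (hQ : 1 ≤ Q) {ξ : ℕ → ℝ} (h0 : 0 < ξ 0) (hmono : ∀ i < n, ξ i ≤ ξ (i + 1)) (hn : ξ n = 1)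
    (hprod : (∏ i ∈ Finset.range (n + 1), ξ i) = Q ^ (-((n : ℝ) + 1)))
    (hξ : ξ 0 ≤ Q ^ (-1 - v)) :
    (∏ i ∈ Finset.range k, ξ i) * Q ^ k ≤ Q ^ (-v) := by
  have hQ0 : 0 < Q := one_pos.trans_le hQ
  have hL : 0 ≤ Real.log Q := Real.log_nonneg hQ
  have hle : ∀ j ≤ n, ∀ i ≤ j, ξ i ≤ ξ j := by
    intro j hj
    induction j with
    | zero => intro i hi; rw [Nat.le_zero.1 hi]
    | succ j ih =>
      intro i hi
      rcases Nat.of_le_succ hi with h | h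
      · exact (ih (by omega) i h).trans (hmono j (by omega))
      · rw [h]
  have hpos : ∀ i ≤ n, 0 < ξ i := fun i hi => h0.trans_le (hle i hi 0 (Nat.zero_le _))
  set z : ℕ → ℝ := fun i => Real.log (ξ i) + Real.log Q with hz
  have hzle : ∀ j ≤ n, ∀ i ≤ j, z i ≤ z j := fun j hj i hi =>
    add_le_add_left (Real.log_le_log (hpos i (hi.trans hj)) (hle j hj i hi)) _
  have hlog : ∀ m ≤ n + 1, ∑ i ∈ Finset.range m, z i =
      Real.log (∏ i ∈ Finset.range m, ξ i) + m * Real.log Q := by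
    intro m hm
    rw [Real.log_prod fun i hi => (hpos i (by have := Finset.mem_range.1 hi; omega)).ne',
      Finset.sum_add_distrib]
    simp
  have hsum : ∑ i ∈ Finset.range (n + 1), z i = 0 := by
    rw [hlog _ le_rfl, hprod, Real.log_rpow hQ0]
    push_cast
    ring
  have hz0 : z 0 ≤ -v * Real.log Q := by
    have := Real.log_le_log h0 hξ
    rw [Real.log_rpow hQ0] at this
    simp only [hz]
    linarith
  have hzn : z n = Real.log Q := by simp [hz, hn]
  have key : ∑ i ∈ Finset.range k, z i ≤ -v * Real.log Q := by
    rcases le_or_gt (z (k - 1)) 0 with h | h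
    · refine le_trans ?_ hz0
      obtain ⟨k, rfl⟩ := Nat.exists_eq_succ_of_ne_zero hk0
      rw [Finset.sum_range_succ']
      have : ∑ i ∈ Finset.range k, z (i + 1) ≤ 0 := Finset.sum_nonpos fun i hi =>
        (hzle k (by omega) (i + 1) (by have := Finset.mem_range.1 hi; omega)).trans h
      linarith
    · have h1 := Finset.sum_range_add_sum_Ico z (show k ≤ n + 1 by omega)
      have h2 : z n ≤ ∑ i ∈ Finset.Ico k (n + 1), z i :=
        Finset.single_le_sum (fun i hi => by
          have := Finset.mem_Ico.1 hi
          exact h.le.trans (hzle i (by omega) _ (by omega))) (Finset.mem_Ico.2 ⟨hkn, by omega⟩)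
      nlinarith
  rw [hlog k (by omega)] at key
  have hp : 0 < ∏ i ∈ Finset.range k, ξ i :=
    Finset.prod_pos fun i hi => hpos i (by have := Finset.mem_range.1 hi; omega)
  rw [← Real.log_le_log_iff (mul_pos hp (pow_pos hQ0 k)) (Real.rpow_pos_of_pos hQ0 _),
    Real.log_mul hp.ne' (pow_pos hQ0 k).ne', Real.log_pow, Real.log_rpow hQ0]
  exact key

lemma exists_minor_ne_zero {n k : ℕ} (hk : k ≤ n + 1) (A : Matrix (Fin k) (Fin (n + 1)) ℤ)
    (hA : LinearIndependent ℚ fun b j => (A b j : ℚ)) :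
    ∃ J : Fin k → Fin (n + 1), (A.submatrix id J).det ≠ 0 := by
  obtain ⟨x, -, hx⟩ := exists_det_jet_ne_zero hk (A.map (Int.castRingHom ℚ)) (fun c hc => by
    rw [Fintype.linearIndependent_iff] at hA
    refine funext fun i => hA c ?_ i
    rw [← hc]
    ext j
    simp [vecMul, dotProduct, Finset.sum_apply]) (s := Set.univ) Set.infinite_univ
  by_contra! h
  apply hx
  rw [det_jet_eq_sum]
  refine Finset.sum_eq_zero fun f _ => ?_
  have : ((A.map (Int.castRingHom ℚ)).submatrix id f).det =
      (((A.submatrix id f).det : ℤ) : ℚ) := ((Int.castRingHom ℚ).map_det _).symm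
  rw [this, h f, Int.cast_zero, mul_zero]

variable {p : ℕ} [hp : Fact p.Prime] {n k : ℕ}

lemma le_covol {w : Fin (n + 1) → ℝ} {H : ℝ} (hw : ∀ i, 0 ≤ w i) (hH : 0 ≤ H)
    (A : Matrix (Fin k) (Fin (n + 1)) ℤ) (I J : Fin k → Fin (n + 1)) {x : ℚ_[p]} {κ : ℝ}
    (hκ : 0 ≤ κ) (hJ : (A.submatrix id J).det ≠ 0)
    (h : κ * ‖((A.submatrix id J).det : ℚ_[p])‖ ≤
      ‖(jet (A.map (Int.castRingHom ℚ_[p])) I x).det‖) :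
    (∏ i, w (I i)) / H ^ k * κ ≤ covol w H A x := by
  have hw' : 0 ≤ ∏ i, w (I i) := Finset.prod_nonneg fun i _ => hw _
  have hHk : 0 ≤ H ^ k := pow_nonneg hH k
  have h1 := mul_le_mul_of_nonneg_left (one_le_norm_mul_abs (p := p) hJ)
    (mul_nonneg (div_nonneg hw' hHk) hκ)
  rw [mul_one] at h1
  refine h1.trans ?_
  refine le_trans (le_of_eq ?_) (mul_le_mul ((mul_le_mul_of_nonneg_left h hw').trans
    (le_jetNorm A x I)) (div_le_div_of_nonneg_right (le_height A J) hHk)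
    (div_nonneg (abs_nonneg _) hHk) (jetNorm_nonneg hw A x))
  ring

lemma det_jet_id (A : Matrix (Fin (n + 1)) (Fin (n + 1)) ℚ_[p]) (x : ℚ_[p]) :
    (jet A id x).det = A.det := by
  have h1 : (jet (1 : Matrix (Fin (n + 1)) (Fin (n + 1)) ℚ_[p]) id x) =
      of fun b a : Fin (n + 1) => (((b : ℕ).choose (a : ℕ) : ℚ_[p]) * x ^ ((b : ℕ) - (a : ℕ))) := by
    ext b a
    rw [jet_apply, Finset.sum_eq_single b]
    · simp
    · intro j _ hj
      simp [one_apply_ne hj.symm]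
    · simp
  have h2 : (jet (1 : Matrix (Fin (n + 1)) (Fin (n + 1)) ℚ_[p]) id x).det = 1 := by
    rw [h1, det_of_isLowerTriangular]
    · simp
    · intro b a hab
      have : (b : ℕ) < a := hab
      rw [of_apply, Nat.choose_eq_zero_of_lt this, Nat.cast_zero, zero_mul]
  have h3 := jet_mul A (1 : Matrix (Fin (n + 1)) (Fin (n + 1)) ℚ_[p]) id x
  rw [Matrix.mul_one] at h3
  rw [h3, det_mul, h2, _root_.mul_one]

lemma one_le_covol_of_card_eq {w : Fin (n + 1) → ℝ} {H : ℝ} (hw : ∀ i, 0 ≤ w i) (hH : 0 ≤ H)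
    (hprod : ∏ i, w i = H ^ (n + 1)) (hH0 : H ≠ 0) (A : Matrix (Fin (n + 1)) (Fin (n + 1)) ℤ)
    (hA : LinearIndependent ℚ fun b j => (A b j : ℚ)) (x : ℚ_[p]) : 1 ≤ covol w H A x := by
  have hdet : A.det ≠ 0 := by
    obtain ⟨J, hJ⟩ := exists_minor_ne_zero le_rfl A hA
    by_cases hJi : Function.Injective J
    · intro h0
      apply hJ
      have := det_permute' (Equiv.ofBijective J (Finite.injective_iff_bijective.1 hJi)) A
      rw [h0, mul_zero] at this
      exact this
    · obtain ⟨a, b, hab, hne⟩ : ∃ a b, J a = J b ∧ a ≠ b := by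
        simpa [Function.Injective, and_comm] using hJi
      exact absurd (det_zero_of_column_eq hne fun c => by simp [hab]) hJ
  have := le_covol hw hH A id id (x := x) zero_le_one hdet (by
    rw [det_jet_id, one_mul, submatrix_id_id]
    exact le_of_eq (congrArg _ ((Int.castRingHom ℚ_[p]).map_det A)))
  refine le_trans (le_of_eq ?_) this
  simp only [id]
  rw [hprod, div_self (pow_ne_zero _ hH0), one_mul]

lemma exists_le_covol (hk : k ≤ n + 1) (c : ℚ_[p]) {r : ℝ} (hr : 0 < r) :
    ∃ κ : ℝ, 0 < κ ∧ ∀ (w : Fin (n + 1) → ℝ) (H : ℝ), (∀ i, 0 ≤ w i) → 0 ≤ H →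
      ∀ A : Matrix (Fin k) (Fin (n + 1)) ℤ, (LinearIndependent ℚ fun b j => (A b j : ℚ)) →
      ∃ x ∈ Metric.closedBall c r,
        (∏ a, w (firstCols hk a)) / H ^ k * κ ≤ covol w H A x := by
  obtain ⟨κ, hκ, h⟩ := exists_jet_lower_bound (p := p) hk c hr
  refine ⟨κ, hκ, fun w H hw hH A hA => ?_⟩
  have hcast : ∀ J : Fin k → Fin (n + 1),
      ((A.map (Int.castRingHom ℚ_[p])).submatrix id J).det =
      (((A.submatrix id J).det : ℤ) : ℚ_[p]) := fun J => ((Int.castRingHom ℚ_[p]).map_det _).symm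
  obtain ⟨J, hJ⟩ := Finite.exists_max fun J : Fin k → Fin (n + 1) =>
    ‖((A.map (Int.castRingHom ℚ_[p])).submatrix id J).det‖
  obtain ⟨x, hx, hle⟩ := h (A.map (Int.castRingHom ℚ_[p])) J hJ
  refine ⟨x, hx, le_covol hw hH A _ J hκ.le ?_ (by rwa [hcast] at hle)⟩
  obtain ⟨J', hJ'⟩ := exists_minor_ne_zero hk A hA
  intro h0
  have := hJ J'
  rw [hcast, hcast, h0, Int.cast_zero, norm_zero, norm_le_zero_iff, Int.cast_eq_zero] at this
  exact hJ' this

end LowerBound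

end QuantNondiv
namespace QuantNondiv

section IntegralBasis

open Matrix Module

variable {n : ℕ}

/-- A basis of the lattice of integer vectors lying in a rational subspace. -/
lemma exists_integral_basis (V : Submodule ℚ (Fin (n + 1) → ℚ)) :
    ∃ A : Matrix (Fin (finrank ℚ V)) (Fin (n + 1)) ℤ,
      LinearIndependent ℚ (fun b j => (A b j : ℚ)) ∧ (∀ b, (fun j => (A b j : ℚ)) ∈ V) ∧
      ∀ a : Fin (n + 1) → ℤ, (fun j => (a j : ℚ)) ∈ V → ∃ c, a = c ᵥ* A := by
  let L : (Fin (n + 1) → ℤ) →ₗ[ℤ] (Fin (n + 1) → ℚ) := (Algebra.linearMap ℤ ℚ).compLeft _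
  have hL : ∀ a j, L a j = (a j : ℚ) := fun a j => rfl
  have hLinj : Function.Injective L := fun a b hab => funext fun j => by
    have := congrFun hab j
    rw [hL, hL] at this
    exact_mod_cast this
  set Λ : Submodule ℤ (Fin (n + 1) → ℤ) := (V.restrictScalars ℤ).comap L with hΛ
  have hmem : ∀ a, a ∈ Λ ↔ L a ∈ V := fun a => Iff.rfl
  let e := finBasis ℤ Λ
  let A : Matrix (Fin (finrank ℤ Λ)) (Fin (n + 1)) ℤ := fun b => (e b : Fin (n + 1) → ℤ)
  have hli : LinearIndependent ℚ (fun b => L (A b)) := by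
    rw [← LinearIndependent.iff_fractionRing ℤ ℚ]
    have h1 := e.linearIndependent.map' Λ.subtype Λ.ker_subtype
    exact h1.map' L (LinearMap.ker_eq_bot.2 hLinj)
  have hcomb : ∀ a : Fin (n + 1) → ℤ, L a ∈ V → ∃ c, a = c ᵥ* A := by
    intro a ha
    refine ⟨e.repr ⟨a, ha⟩, ?_⟩
    have h1 := congrArg Subtype.val (e.sum_repr ⟨a, ha⟩)
    rw [Submodule.coe_sum] at h1
    refine h1.symm.trans ?_
    ext j
    simp [vecMul, dotProduct, Finset.sum_apply, A]
  have hspan : Submodule.span ℚ (Set.range fun b => L (A b)) = V := by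
    refine le_antisymm (Submodule.span_le.2 ?_) fun v hv => ?_
    · rintro _ ⟨b, rfl⟩
      exact (e b).2
    · obtain ⟨N, hN⟩ := IsLocalization.exist_integer_multiples_of_finite (nonZeroDivisors ℤ) v
      choose a ha using hN
      have hNa : L a = (N : ℤ) • v := funext fun j => by
        rw [hL, Pi.smul_apply, ← ha j]; rfl
      obtain ⟨c, hc⟩ := hcomb a (by rw [hNa]; exact V.smul_of_tower_mem (N : ℤ) hv)
      have hN0 : ((N : ℤ) : ℚ) ≠ 0 := Int.cast_ne_zero.2 (nonZeroDivisors.ne_zero N.2)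
      have hv' : v = ((N : ℤ) : ℚ)⁻¹ • L a := by
        rw [hNa, ← Int.cast_smul_eq_zsmul ℚ, smul_smul, inv_mul_cancel₀ hN0, one_smul]
      rw [hv']
      refine Submodule.smul_mem _ _ ?_
      have hLa : L a = ∑ b, c b • L (A b) := by
        rw [hc, vecMul_eq_sum, map_sum]
        exact Finset.sum_congr rfl fun b _ => map_smul L _ _
      rw [hLa]
      exact Submodule.sum_mem _ fun b _ => Submodule.smul_of_tower_mem _ _
        (Submodule.subset_span (Set.mem_range_self b))
  have hrank : finrank ℚ V = finrank ℤ Λ := by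
    have h1 := finrank_span_eq_card hli
    rwa [hspan, Fintype.card_fin] at h1
  rw [hrank]
  exact ⟨A, hli, fun b => (e b).2, hcomb⟩

/-- A chosen basis of the lattice of integer vectors lying in a rational subspace. -/
noncomputable def integralBasis (V : Submodule ℚ (Fin (n + 1) → ℚ)) :
    Matrix (Fin (finrank ℚ V)) (Fin (n + 1)) ℤ := (exists_integral_basis V).choose

lemma linearIndependent_integralBasis (V : Submodule ℚ (Fin (n + 1) → ℚ)) :
    LinearIndependent ℚ (fun b j => (integralBasis V b j : ℚ)) :=
  (exists_integral_basis V).choose_spec.1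

lemma integralBasis_mem (V : Submodule ℚ (Fin (n + 1) → ℚ)) (b : Fin (finrank ℚ V)) :
    (fun j => (integralBasis V b j : ℚ)) ∈ V :=
  (exists_integral_basis V).choose_spec.2.1 b

lemma exists_eq_vecMul_integralBasis (V : Submodule ℚ (Fin (n + 1) → ℚ)) {a : Fin (n + 1) → ℤ}
    (ha : (fun j => (a j : ℚ)) ∈ V) : ∃ c, a = c ᵥ* integralBasis V :=
  (exists_integral_basis V).choose_spec.2.2 a ha

variable {p : ℕ} [hp : Fact p.Prime] {w : Fin (n + 1) → ℝ} {H : ℝ}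

/-- The covolume of the lattice of integer vectors in a rational subspace. -/
noncomputable def subspaceCovol (w : Fin (n + 1) → ℝ) (H : ℝ) (V : Submodule ℚ (Fin (n + 1) → ℚ))
    (x : ℚ_[p]) : ℝ := covol w H (integralBasis V) x

lemma subspaceCovol_le (hw : ∀ i, 0 ≤ w i) (hH : 0 ≤ H) (V : Submodule ℚ (Fin (n + 1) → ℚ)) {k : ℕ}
    (hk : finrank ℚ V = k) (B : Matrix (Fin k) (Fin (n + 1)) ℤ)
    (hB : LinearIndependent ℚ fun b j => (B b j : ℚ)) (hBV : ∀ b, (fun j => (B b j : ℚ)) ∈ V)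
    (x : ℚ_[p]) : subspaceCovol w H V x ≤ covol w H B x := by
  subst hk
  choose T hT using fun b => exists_eq_vecMul_integralBasis V (hBV b)
  have hTB : B = of T * integralBasis V := by
    ext b j
    exact congrFun (hT b) j
  have hdet : (of T).det ≠ 0 := by
    intro h0
    obtain ⟨u, hu0, hu⟩ := exists_vecMul_eq_zero_iff.2 h0
    have huB : u ᵥ* B = 0 := by rw [hTB, ← vecMul_vecMul, hu, zero_vecMul]
    rw [Fintype.linearIndependent_iff] at hB
    apply hu0
    ext b
    have := hB (fun b => (u b : ℚ)) (by
      ext j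
      have h1 := congrFun huB j
      rw [vecMul, dotProduct] at h1
      simp only [Finset.sum_apply, Pi.smul_apply, smul_eq_mul, Pi.zero_apply]
      exact_mod_cast h1) b
    exact_mod_cast this
  rw [hTB]
  exact covol_le_covol_mul hw hH _ hdet x

lemma subspaceCovol_bot (x : ℚ_[p]) :
    subspaceCovol w H (⊥ : Submodule ℚ (Fin (n + 1) → ℚ)) x = 1 := by
  rw [subspaceCovol]
  generalize integralBasis (⊥ : Submodule ℚ (Fin (n + 1) → ℚ)) = A
  have h0 : finrank ℚ (⊥ : Submodule ℚ (Fin (n + 1) → ℚ)) = 0 := finrank_bot ℚ _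
  revert A
  rw [h0]
  exact fun A => covol_of_isEmpty A x

end IntegralBasis

section MarkedPoints

open Matrix Module

variable {n : ℕ} {p : ℕ} [hp : Fact p.Prime] {w : Fin (n + 1) → ℝ} {H : ℝ}

lemma le_vecSize_of_marked (hw : ∀ i, 0 ≤ w i) (hH : 0 < H) {ε : ℝ} (hε : ε ≤ 1) {x : ℚ_[p]}
    (hx : Marked (fun V W : Submodule ℚ (Fin (n + 1) → ℚ) => V < W ∨ W < V)
      (subspaceCovol w H) ε ∅ x)
    {a : Fin (n + 1) → ℤ} (ha : a ≠ 0) : ε ≤ (n + 1) * vecSize w H a x := by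
  classical
  obtain ⟨F, -, hF, hF1, hF2⟩ := hx
  set v : Fin (n + 1) → ℚ := fun j => (a j : ℚ) with hv
  have hv0 : v ≠ 0 := fun h => ha (funext fun j => by
    have := congrFun h j
    simpa [hv] using this)
  obtain ⟨W, hW, hmax⟩ := Finset.exists_max_image ((insert ⊥ F).filter fun U => v ∉ U)
    (fun U => finrank ℚ U) ⟨⊥, by simp [hv0]⟩
  obtain ⟨hWF, hvW⟩ := Finset.mem_filter.1 hW
  have hbelow : ∀ U ∈ F, v ∉ U → U ≤ W := by
    intro U hU hvU
    have hr := hmax U (Finset.mem_filter.2 ⟨Finset.mem_insert_of_mem hU, hvU⟩)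
    rcases Finset.mem_insert.1 hWF with rfl | hWF
    · rw [finrank_bot, Nat.le_zero, Submodule.finrank_eq_zero] at hr
      exact hr.le
    · by_cases hUW : U = W
      · exact hUW.le
      · rcases hF hU hWF hUW with h | h
        · exact h.le
        · exact absurd (Submodule.finrank_lt_finrank_of_lt h) (not_lt.2 hr)
  have habove : ∀ U ∈ F, v ∈ U → W ≤ U := by
    intro U hU hvU
    rcases Finset.mem_insert.1 hWF with rfl | hWF
    · exact bot_le
    · rcases hF hU hWF (fun h => hvW (h ▸ hvU)) with h | h
      · exact absurd (h.le hvU) hvW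
      · exact h.le
  have hW1 : subspaceCovol w H W x ≤ 1 := by
    rcases Finset.mem_insert.1 hWF with h | h
    · rw [h, subspaceCovol_bot]
    · exact (hF1 W h (Finset.notMem_empty _)).2
  set Δ := W ⊔ Submodule.span ℚ {v} with hΔ
  have hvΔ : v ∈ Δ := Submodule.mem_sup_right (Submodule.mem_span_singleton_self v)
  have hWΔ : W < Δ := lt_of_le_of_ne le_sup_left fun h => hvW (by rw [h]; exact hvΔ)
  have hΔε : ε ≤ subspaceCovol w H Δ x := by
    by_cases hΔF : Δ ∈ F
    · exact (hF1 Δ hΔF (Finset.notMem_empty _)).1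
    · refine hε.trans (hF2 Δ fun t ht => ?_)
      by_cases hvt : v ∈ t
      · refine Or.inl (lt_of_le_of_ne (sup_le (habove t ht hvt) ?_) fun h => hΔF (h ▸ ht))
        rwa [Submodule.span_singleton_le_iff_mem]
      · exact Or.inr ((hbelow t ht hvt).trans_lt hWΔ)
  have hle : subspaceCovol w H Δ x ≤ covol w H (of (vecCons a (integralBasis W))) x := by
    refine subspaceCovol_le hw hH.le Δ (Submodule.finrank_sup_span_singleton hvW) _ ?_ ?_ x
    · have h1 : (fun (b : Fin (finrank ℚ W + 1)) j =>
          ((of (vecCons a (integralBasis W)) b j : ℤ) : ℚ)) =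
          Fin.cons v fun b j => (integralBasis W b j : ℚ) := by
        funext b
        exact Fin.cases rfl (fun b => rfl) b
      rw [h1, linearIndependent_finCons]
      refine ⟨linearIndependent_integralBasis W, fun h => hvW ?_⟩
      refine Submodule.span_le.2 ?_ h
      rintro _ ⟨b, rfl⟩
      exact integralBasis_mem W b
    · intro b
      refine Fin.cases ?_ (fun b => ?_) b
      · exact hvΔ
      · exact hWΔ.le (integralBasis_mem W b)
  have hkn : finrank ℚ W ≤ n := by
    have h1 : finrank ℚ W < finrank ℚ (Fin (n + 1) → ℚ) :=
      Submodule.finrank_lt (hWΔ.trans_le le_top).ne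
    rw [finrank_fin_fun] at h1
    omega
  have hvec : 0 ≤ vecSize w H a x := mul_nonneg
    (Real.iSup_nonneg fun i => mul_nonneg (hw i) (norm_nonneg _))
    (Real.iSup_nonneg fun j => div_nonneg (abs_nonneg _) hH.le)
  calc ε ≤ (finrank ℚ W + 1) * subspaceCovol w H W x * vecSize w H a x :=
        hΔε.trans (hle.trans (covol_vecCons_le hw hH a _ x))
    _ ≤ (n + 1) * vecSize w H a x := by
        refine mul_le_mul_of_nonneg_right ?_ hvec
        have h2 : (finrank ℚ W : ℝ) ≤ n := by exact_mod_cast hkn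
        nlinarith [Nat.cast_nonneg (α := ℝ) (finrank ℚ W)]

lemma card_le_of_pairwise_comparable (F : Finset (Submodule ℚ (Fin (n + 1) → ℚ)))
    (hF : (F : Set (Submodule ℚ (Fin (n + 1) → ℚ))).Pairwise fun V W => V < W ∨ W < V) :
    F.card ≤ n + 2 := by
  rw [← Finset.card_range (n + 2)]
  refine Finset.card_le_card_of_injOn (fun V => finrank ℚ V) (fun V _ => ?_) fun V hV W hW h => ?_
  · have := Submodule.finrank_le V
    rw [finrank_fin_fun] at this
    simp only [Finset.coe_range, Set.mem_Iio]
    omega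
  · by_contra hne
    rcases hF hV hW hne with h' | h'
    · exact absurd h (Submodule.finrank_lt_finrank_of_lt h').ne
    · exact absurd h (Submodule.finrank_lt_finrank_of_lt h').ne'

end MarkedPoints

end QuantNondiv
namespace QuantNondiv

section Threshold

open Matrix Module

variable {n : ℕ} {p : ℕ} [hp : Fact p.Prime]

lemma exists_one_le_subspaceCovol (n : ℕ) (c : ℚ_[p]) {r v : ℝ} (hr : 0 < r) (hv0 : 0 < v)
    (hv1 : v ≤ 1) :
    ∃ Q₀ : ℝ, 1 ≤ Q₀ ∧ ∀ Q : ℝ, Q₀ ≤ Q → ∀ δ : ℝ, 0 < δ → ∀ ξ : ℕ → ℝ, 0 < ξ 0 →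
      (∀ i ≤ n, 0 < ξ i) → (∀ i < n, ξ i ≤ ξ (i + 1)) → ξ n = 1 →
      (∏ i ∈ Finset.range (n + 1), ξ i) = Q ^ (-((n : ℝ) + 1)) → ξ 0 ≤ Q ^ (-1 - v) →
      ∀ V : Submodule ℚ (Fin (n + 1) → ℚ), ∃ y ∈ Metric.closedBall c r,
        1 ≤ subspaceCovol (fun i => δ / ξ i) (δ * Q) V y := by
  choose κ hκ0 hκ using fun k : Fin (n + 2) =>
    exists_le_covol (p := p) (Nat.le_of_lt_succ k.2) c hr
  obtain ⟨k₀, hk₀⟩ := Finite.exists_min κ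
  refine ⟨max 1 ((κ k₀)⁻¹ ^ v⁻¹), le_max_left _ _, fun Q hQ δ hδ ξ h0 hpos hmono hn hprod hξ V => ?_⟩
  have hQ1 : 1 ≤ Q := (le_max_left _ _).trans hQ
  have hQ0 : 0 < Q := one_pos.trans_le hQ1
  have hH : 0 < δ * Q := mul_pos hδ hQ0
  have hw : ∀ i : Fin (n + 1), 0 ≤ δ / ξ i := fun i =>
    (div_pos hδ (hpos i (Nat.le_of_lt_succ i.2))).le
  have hκQ : (κ k₀)⁻¹ ≤ Q ^ v := by
    have h1 := Real.rpow_le_rpow (Real.rpow_nonneg (inv_pos.2 (hκ0 k₀)).le _)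
      ((le_max_right _ _).trans hQ) hv0.le
    rwa [Real.rpow_inv_rpow (inv_pos.2 (hκ0 k₀)).le hv0.ne'] at h1
  have hbase := linearIndependent_integralBasis V
  have hrank : finrank ℚ V ≤ n + 1 := by
    have := Submodule.finrank_le V
    rwa [finrank_fin_fun] at this
  unfold subspaceCovol
  revert hbase
  generalize integralBasis V = A
  revert A
  generalize finrank ℚ V = k at hrank ⊢
  intro A hA
  rcases Nat.eq_zero_or_pos k with rfl | hk
  · exact ⟨c, Metric.mem_closedBall_self hr.le, (covol_of_isEmpty A c).ge⟩
  rcases hrank.eq_or_lt with rfl | hkn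
  · refine ⟨c, Metric.mem_closedBall_self hr.le, one_le_covol_of_card_eq hw hH.le ?_ hH.ne' A hA c⟩
    rw [Fin.prod_univ_eq_prod_range (fun i => δ / ξ i) (n + 1), Finset.prod_div_distrib, hprod,
      Finset.prod_const, Finset.card_range, mul_pow, Real.rpow_neg hQ0.le, div_inv_eq_mul]
    norm_cast
  · obtain ⟨y, hy, hle⟩ := hκ ⟨k, by omega⟩ _ _ hw hH.le A hA
    refine ⟨y, hy, le_trans ?_ hle⟩
    have hpk : 0 < ∏ i ∈ Finset.range k, ξ i := Finset.prod_pos fun i hi =>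
      hpos i (by have := Finset.mem_range.1 hi; omega)
    have h1 : (∏ a : Fin k, δ / ξ (firstCols hrank a)) = δ ^ k / ∏ i ∈ Finset.range k, ξ i := by
      rw [← Fin.prod_univ_eq_prod_range ξ k, Finset.prod_div_distrib]
      simp [firstCols]
    have h2 := prod_weights_mul_pow_le hk.ne' (by omega) hv1 hQ1 h0 hmono hn hprod hξ
    have h3 : δ ^ k / (∏ i ∈ Finset.range k, ξ i) / (δ * Q) ^ k =
        ((∏ i ∈ Finset.range k, ξ i) * Q ^ k)⁻¹ := by
      rw [mul_pow]
      field_simp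
    rw [h1, h3]
    have h4 : Q ^ v ≤ ((∏ i ∈ Finset.range k, ξ i) * Q ^ k)⁻¹ := by
      rw [le_inv_comm₀ (Real.rpow_pos_of_pos hQ0 v) (mul_pos hpk (pow_pos hQ0 k)),
        ← Real.rpow_neg hQ0.le]
      exact h2
    calc (1 : ℝ) = (κ k₀)⁻¹ * κ k₀ := (inv_mul_cancel₀ (hκ0 k₀).ne').symm
      _ ≤ _ := mul_le_mul (hκQ.trans h4) (hk₀ _) (hκ0 k₀).le
        (inv_pos.2 (mul_pos hpk (pow_pos hQ0 k))).le

end Threshold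

section Clearing

variable {n : ℕ} {p : ℕ} [hp : Fact p.Prime]

/-- Multiplying a vector over `ℤ[1/p]` by a power of `p` does not change its size. -/
lemma exists_vecSize_eq (w : Fin (n + 1) → ℝ) (H : ℝ) {a : Fin (n + 1) → ℚ} (ha : a ≠ 0)
    (hp' : ∀ j, ∃ (k : ℤ) (m : ℕ), a j = (k : ℚ) / (p : ℚ) ^ m) :
    ∃ b : Fin (n + 1) → ℤ, b ≠ 0 ∧ ∀ x : ℚ_[p], vecSize w H b x =
      (⨆ i : Fin (n + 1), w i * ‖∑ j : Fin (n + 1),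
        (((j : ℕ).choose (i : ℕ) : ℚ_[p]) * ((a j : ℚ) : ℚ_[p]) * x ^ ((j : ℕ) - (i : ℕ)))‖) *
      (⨆ j : Fin (n + 1), |((a j : ℚ) : ℝ)| / H) := by
  choose k m hkm using hp'
  have hpQ : (p : ℚ) ≠ 0 := Nat.cast_ne_zero.2 hp.out.ne_zero
  have hpR : (0 : ℝ) < p := Nat.cast_pos.2 hp.out.pos
  set M := ∑ j, m j with hM
  have hb : ∀ j, ((k j * (p : ℤ) ^ (M - m j) : ℤ) : ℚ) = (p : ℚ) ^ M * a j := by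
    intro j
    have hj : m j ≤ M := Finset.single_le_sum (fun _ _ => Nat.zero_le _) (Finset.mem_univ j)
    rw [hkm j]
    push_cast
    rw [pow_sub₀ _ hpQ hj]
    field_simp
  refine ⟨fun j => k j * (p : ℤ) ^ (M - m j), fun h => ha (funext fun j => ?_), fun x => ?_⟩
  · have h1 := hb j
    rw [show k j * (p : ℤ) ^ (M - m j) = 0 from congrFun h j, Int.cast_zero] at h1
    exact (mul_eq_zero.1 h1.symm).resolve_left (pow_ne_zero _ hpQ)
  · have hbp : ∀ j, ((k j * (p : ℤ) ^ (M - m j) : ℤ) : ℚ_[p]) = (p : ℚ_[p]) ^ M * (a j : ℚ_[p]) := by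
      intro j
      exact_mod_cast congrArg (fun q : ℚ => (q : ℚ_[p])) (hb j)
    have hbr : ∀ j, ((k j * (p : ℤ) ^ (M - m j) : ℤ) : ℝ) = (p : ℝ) ^ M * (a j : ℝ) := by
      intro j
      exact_mod_cast congrArg (fun q : ℚ => (q : ℝ)) (hb j)
    have h1 : (⨆ i : Fin (n + 1), w i * ‖∑ j : Fin (n + 1), (((j : ℕ).choose (i : ℕ) : ℚ_[p]) *
        ((k j * (p : ℤ) ^ (M - m j) : ℤ) : ℚ_[p]) * x ^ ((j : ℕ) - (i : ℕ)))‖) =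
        ((p : ℝ) ^ M)⁻¹ * ⨆ i : Fin (n + 1), w i * ‖∑ j : Fin (n + 1),
          (((j : ℕ).choose (i : ℕ) : ℚ_[p]) * ((a j : ℚ) : ℚ_[p]) * x ^ ((j : ℕ) - (i : ℕ)))‖ := by
      rw [Real.mul_iSup_of_nonneg (inv_pos.2 (pow_pos hpR M)).le]
      refine congrArg _ (funext fun i => ?_)
      have h2 : (∑ j : Fin (n + 1), (((j : ℕ).choose (i : ℕ) : ℚ_[p]) *
          ((k j * (p : ℤ) ^ (M - m j) : ℤ) : ℚ_[p]) * x ^ ((j : ℕ) - (i : ℕ)))) =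
          (p : ℚ_[p]) ^ M * ∑ j : Fin (n + 1), (((j : ℕ).choose (i : ℕ) : ℚ_[p]) *
            ((a j : ℚ) : ℚ_[p]) * x ^ ((j : ℕ) - (i : ℕ))) := by
        rw [Finset.mul_sum]
        refine Finset.sum_congr rfl fun j _ => ?_
        rw [hbp]
        ring
      rw [h2, norm_mul, norm_pow, Padic.norm_p, inv_pow]
      ring
    have h3 : (⨆ j : Fin (n + 1), |((k j * (p : ℤ) ^ (M - m j) : ℤ) : ℝ)| / H) =
        (p : ℝ) ^ M * ⨆ j : Fin (n + 1), |((a j : ℚ) : ℝ)| / H := by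
      rw [Real.mul_iSup_of_nonneg (pow_pos hpR M).le]
      refine congrArg _ (funext fun j => ?_)
      rw [hbr, abs_mul, abs_of_pos (pow_pos hpR M), mul_div_assoc]
    rw [vecSize, h1, h3, mul_mul_mul_comm, inv_mul_cancel₀ (pow_pos hpR M).ne', one_mul]

end Clearing

section Ball

variable {p : ℕ} [hp : Fact p.Prime]

lemma exists_closedBall_eq_zpow (c : ℚ_[p]) {r : ℝ} (hr : 0 < r) :
    ∃ k : ℤ, Metric.closedBall c r = Metric.closedBall c ((p : ℝ) ^ (-k)) := by
  obtain ⟨m, hm, hm'⟩ := exists_mem_Ico_zpow hr (Nat.one_lt_cast.2 hp.out.one_lt : (1 : ℝ) < p)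
  refine ⟨-m, ?_⟩
  rw [neg_neg]
  refine Set.Subset.antisymm (fun x hx => ?_) (Metric.closedBall_subset_closedBall hm)
  rw [mem_closedBall_iff_norm] at hx ⊢
  exact (Padic.norm_le_pow_iff_norm_lt_pow_add_one _ _).2 (hx.trans_lt hm')

lemma mul_sub_le_floor (n k : ℕ) : k * (n + 1 - k) ≤ ⌊(((n : ℝ) + 1) / 2) ^ 2⌋₊ := by
  rcases le_total k (n + 1) with hk | hk
  · refine Nat.le_floor ?_
    push_cast [Nat.cast_sub hk]
    nlinarith [sq_nonneg ((n : ℝ) + 1 - 2 * k)]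
  · simp [Nat.sub_eq_zero_of_le hk]

end Ball

section Main

open Module

variable {p : ℕ} [hp : Fact p.Prime]

lemma measure_exists_vecSize_lt_le (μ : Measure ℚ_[p]) [μ.IsAddHaarMeasure] {n d : ℕ} (hd : d ≠ 0)
    (hkd : ∀ k, k * (n + 1 - k) ≤ d) {w : Fin (n + 1) → ℝ} {H : ℝ} (hw : ∀ i, 0 ≤ w i) (hH : 0 < H)
    {ε : ℝ} (hε : 0 < ε) (hε1 : ε ≤ 1) (c : ℚ_[p]) {r : ℝ} (hr : 0 < r)
    (hbig : ∀ V : Submodule ℚ (Fin (n + 1) → ℚ), ∃ y ∈ Metric.closedBall c r,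
      1 ≤ subspaceCovol w H V y) :
    μ {x ∈ Metric.closedBall c r | ∃ a : Fin (n + 1) → ℤ, a ≠ 0 ∧ vecSize w H a x < ε} ≤
      ENNReal.ofReal (((2 * p) ^ (n + 2) * (d * p) + 1) * (n + 1) * ε ^ (d : ℝ)⁻¹) *
        μ (Metric.closedBall c r) := by
  obtain ⟨k, hk⟩ := exists_closedBall_eq_zpow c hr
  rw [hk] at hbig ⊢
  have hd1 : (d : ℝ)⁻¹ ≤ 1 := inv_le_one_of_one_le₀ (by exact_mod_cast Nat.one_le_iff_ne_zero.2 hd)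
  have hd0 : (0 : ℝ) ≤ (d : ℝ)⁻¹ := by positivity
  have hn1 : (1 : ℝ) ≤ n + 1 := by linarith [Nat.cast_nonneg (α := ℝ) n]
  have hεp : 0 < ε ^ (d : ℝ)⁻¹ := Real.rpow_pos_of_pos hε _
  set D : ℝ := (2 * p) ^ (n + 2) * (d * p) with hD
  have hD0 : 0 ≤ D := by positivity
  rcases le_or_gt ((n + 1) * ε) 1 with h1 | h1
  · have hsub : {x ∈ Metric.closedBall c ((p : ℝ) ^ (-k)) |
        ∃ a : Fin (n + 1) → ℤ, a ≠ 0 ∧ vecSize w H a x < ε} ⊆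
        {x ∈ Metric.closedBall c ((p : ℝ) ^ (-k)) |
          ¬ Marked (fun V W : Submodule ℚ (Fin (n + 1) → ℚ) => V < W ∨ W < V)
            (subspaceCovol w H) ((n + 1) * ε) ∅ x} := by
      rintro x ⟨hx, a, ha, hlt⟩
      refine ⟨hx, fun hm => ?_⟩
      exact absurd (le_vecSize_of_marked hw hH h1 hm ha)
        (not_le.2 (mul_lt_mul_of_pos_left hlt (by linarith)))
    have h2 := measure_not_marked_le μ (fun V W : Submodule ℚ (Fin (n + 1) → ℚ) => V < W ∨ W < V)
      (fun _ _ => Or.symm) (fun V => by simp) (n + 2) card_le_of_pairwise_comparable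
      (subspaceCovol w H) (fun V => continuous_covol _) ((n + 1) * ε)
      (ENNReal.ofReal (d * p * ((n + 1) * ε) ^ (d : ℝ)⁻¹))
      (fun V c k h => covol_good μ hw hH.le _ hd (hkd _) (by positivity) c k h)
      (n + 2) ∅ (by simp) (by simp) c k (fun V _ => hbig V)
    refine (measure_mono hsub).trans (h2.trans ?_)
    gcongr
    rw [← ENNReal.ofReal_natCast, ← ENNReal.ofReal_pow (Nat.cast_nonneg _),
      ← ENNReal.ofReal_mul (by positivity)]
    refine ENNReal.ofReal_le_ofReal ?_
    rw [Real.mul_rpow (by linarith) hε.le]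
    have h3 : ((n : ℝ) + 1) ^ (d : ℝ)⁻¹ ≤ n + 1 := by
      simpa using Real.rpow_le_rpow_of_exponent_le hn1 hd1
    calc (((2 * p : ℕ) : ℝ)) ^ (n + 2) * (d * p * (((n : ℝ) + 1) ^ (d : ℝ)⁻¹ * ε ^ (d : ℝ)⁻¹))
        = D * ((n : ℝ) + 1) ^ (d : ℝ)⁻¹ * ε ^ (d : ℝ)⁻¹ := by rw [hD]; push_cast; ring
      _ ≤ (D + 1) * (n + 1) * ε ^ (d : ℝ)⁻¹ := by
        gcongr
        linarith
  · refine (measure_mono (Set.sep_subset _ _)).trans (le_mul_of_one_le_left zero_le ?_)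
    rw [ENNReal.one_le_ofReal]
    have h2 : ε ≤ ε ^ (d : ℝ)⁻¹ := by
      simpa using Real.rpow_le_rpow_of_exponent_ge hε hε1 hd1
    nlinarith [mul_nonneg hD0 (mul_nonneg (by linarith : (0 : ℝ) ≤ n + 1) hεp.le)]

end Main

end QuantNondiv

/-- **Quantitative non-divergence, specialized.** Let `n ≥ 2`, `p` prime,
`α := 1/⌊((n+1)/2)²⌋`. There is `K > 0` depending only on `n` and `p` such that: for any
`0 < v ≤ 1` and any nonempty ball `B ⊆ ℤ_p` there is `Q₀` such that for every `Q ≥ Q₀` which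
is an integer power of `p`, every `δ ∈ (0,1)` which is an integer power of `p`, all
`ξ₀, …, ξ_n`, integer powers of `p`, with `0 < ξ₀ ≤ ⋯ ≤ ξ_n = 1`, `∏ ξ_i = Q^{−(n+1)}`,
`ξ₀ ≤ Q^{−1−v}`, and every `0 < ε ≤ 1`:
`μ{x ∈ B : ∃ a ∈ ℤ[1/p]^{n+1} \ {0},
  (max_i (δ/ξ_i)|Σ_j C(j,i) a_j x^{j−i}|_p) · (max_j |a_j|/(δQ)) < ε} ≤ K ε^α μ(B)`.

Here `μ` is the Haar measure on `ℚ_p` normalized so that `μ(ℤ_p) = 1`; elements of `ℤ[1/p]`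
are represented as rationals of the form `k/p^m`, viewed in `ℚ_p` for `|·|_p` and in `ℝ` for
the ordinary absolute value. -/
theorem stmt15 (p : ℕ) [Fact p.Prime] (n : ℕ) (hn : 2 ≤ n)
    (μ : Measure ℚ_[p]) [μ.IsAddHaarMeasure]
    (hμ : μ {x : ℚ_[p] | ‖x‖ ≤ 1} = 1) :
    ∃ K : ℝ, 0 < K ∧
      ∀ v : ℝ, 0 < v → v ≤ 1 →
      ∀ (x₀ : ℤ_[p]) (r : ℝ), 0 < r → r ≤ 1 →
      ∃ Q₀ : ℝ, ∀ Q : ℝ, Q₀ ≤ Q → (∃ m : ℤ, Q = (p : ℝ) ^ m) →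
      ∀ δ : ℝ, 0 < δ → δ < 1 → (∃ m : ℤ, δ = (p : ℝ) ^ m) →
      ∀ ξ : ℕ → ℝ, (∀ i ≤ n, ∃ m : ℤ, ξ i = (p : ℝ) ^ m) →
        0 < ξ 0 → (∀ i < n, ξ i ≤ ξ (i + 1)) → ξ n = 1 →
        (∏ i ∈ Finset.range (n + 1), ξ i) = Q ^ (-((n : ℝ) + 1)) →
        ξ 0 ≤ Q ^ (-1 - v) →
      ∀ ε : ℝ, 0 < ε → ε ≤ 1 →
        μ {x : ℚ_[p] | ‖x - (x₀ : ℚ_[p])‖ ≤ r ∧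
            ∃ a : Fin (n + 1) → ℚ, a ≠ 0 ∧
              (∀ j : Fin (n + 1), ∃ (k : ℤ) (m : ℕ), a j = (k : ℚ) / (p : ℚ) ^ m) ∧
              (⨆ i : Fin (n + 1), (δ / ξ (i : ℕ)) *
                  ‖∑ j : Fin (n + 1),
                    (((j : ℕ).choose (i : ℕ) : ℚ_[p]) * ((a j : ℚ) : ℚ_[p]) *
                      x ^ ((j : ℕ) - (i : ℕ)))‖) *
                (⨆ j : Fin (n + 1), |((a j : ℚ) : ℝ)| / (δ * Q)) < ε} ≤
          ENNReal.ofReal (K * ε ^ ((⌊(((n : ℝ) + 1) / 2) ^ 2⌋₊ : ℝ)⁻¹)) *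
            μ {x : ℚ_[p] | ‖x - (x₀ : ℚ_[p])‖ ≤ r} := by
  set d := ⌊(((n : ℝ) + 1) / 2) ^ 2⌋₊ with hd
  have hkd : ∀ k, k * (n + 1 - k) ≤ d := QuantNondiv.mul_sub_le_floor n
  have hd0 : d ≠ 0 := fun h => by
    have := hkd 1
    omega
  have hp : 0 < p := (Fact.out : p.Prime).pos
  refine ⟨((2 * p) ^ (n + 2) * (d * p) + 1) * (n + 1), by positivity, ?_⟩
  intro v hv0 hv1 x₀ r hr _
  obtain ⟨Q₀, hQ₀, hbig⟩ := QuantNondiv.exists_one_le_subspaceCovol n (x₀ : ℚ_[p]) hr hv0 hv1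
  refine ⟨Q₀, ?_⟩
  intro Q hQ _ δ hδ _ _ ξ hξp h0 hmono hξn hprod hξ ε hε hε1
  have hpos : ∀ i ≤ n, 0 < ξ i := fun i hi => by
    obtain ⟨m, hm⟩ := hξp i hi
    rw [hm]
    positivity
  have hball : {x : ℚ_[p] | ‖x - (x₀ : ℚ_[p])‖ ≤ r} = Metric.closedBall (x₀ : ℚ_[p]) r := by
    ext x
    rw [mem_closedBall_iff_norm]
    rfl
  rw [hball]
  refine (measure_mono ?_).trans (QuantNondiv.measure_exists_vecSize_lt_le μ hd0 hkd
    (w := fun i => δ / ξ i) (H := δ * Q)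
    (fun i => (div_pos hδ (hpos i (Nat.le_of_lt_succ i.2))).le)
    (mul_pos hδ (one_pos.trans_le (hQ₀.trans hQ))) hε hε1 x₀ hr
    (hbig Q hQ δ hδ ξ h0 hpos hmono hξn hprod hξ))
  rintro x ⟨hx, a, ha, hpa, hlt⟩
  obtain ⟨b, hb, hab⟩ := QuantNondiv.exists_vecSize_eq (fun i => δ / ξ i) (δ * Q) ha hpa
  exact ⟨mem_closedBall_iff_norm.2 hx, b, hb, (hab x).trans_lt hlt⟩
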